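/- Let ε ∈ (0,1). There exists C_ε > 0 such that for every integer i ≥ 1 and every x ∈ [−1,1], (1/i) · ∑ |Ỹ_{ℓ,m}(x)|² ≤ C_ε, where the sum is over all (ℓ,m) ∈ ℕ×ℤ with |m| ≤ ℓ, |m| ≤ ε(ℓ+1/2) and λ_{ℓ,m} ∈ [i², (i+1)²]. -/

import Mathlib

open MeasureTheory Set
open scoped ENNReal NNReal

noncomputable section

/-- The Legendre polynomial `P_ℓ(x) = (2^ℓ ℓ!)⁻¹ (d/dx)^ℓ (x²−1)^ℓ`. -/
def legendreP (n : ℕ) (x : ℝ) : ℝ :=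
  ((2:ℝ)^n * (Nat.factorial n : ℝ))⁻¹ * iteratedDeriv n (fun y => (y^2 - 1)^n) x

/-- The associated Legendre function `P_ℓ^m` for `0 ≤ m ≤ ℓ`
(on `[-1,1]`, where `√(1-x²)^m = (1-x²)^{m/2}`). -/
def assocP (n m : ℕ) (x : ℝ) : ℝ :=
  (-1:ℝ)^m * Real.sqrt (1 - x^2) ^ m * iteratedDeriv m (legendreP n) x

/-- The associated Legendre function `P_ℓ^m` for integer `m` with `|m| ≤ ℓ`. -/
def assocPZ (n : ℕ) (m : ℤ) (x : ℝ) : ℝ :=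
  if 0 ≤ m then assocP n m.toNat x
  else (-1:ℝ)^m.natAbs *
    ((Nat.factorial (n - m.natAbs) : ℝ) / (Nat.factorial (n + m.natAbs) : ℝ)) *
    assocP n m.natAbs x

/-- `Ỹ_{ℓ,m}(x) = ((2ℓ+1)/(4π) · (ℓ−m)!/(ℓ+m)!)^{1/2} P_ℓ^m(x)`. -/
def tY (n : ℕ) (m : ℤ) (x : ℝ) : ℝ :=
  Real.sqrt (((2*(n:ℝ)+1) / (4*Real.pi)) *
    ((Nat.factorial ((n : ℤ) - m).toNat : ℝ) / (Nat.factorial ((n : ℤ) + m).toNat : ℝ))) *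
  assocPZ n m x

/-- The eigenvalue `λ_{ℓ,m} = ℓ(ℓ+1) − m²`. -/
def eigenL (n : ℕ) (m : ℤ) : ℝ := (n : ℝ) * ((n : ℝ) + 1) - (m : ℝ)^2

open Polynomial in
/-- The Legendre polynomial as an element of `ℝ[X]`. -/
def legendrePoly (n : ℕ) : ℝ[X] :=
  C (((2:ℝ)^n * (Nat.factorial n : ℝ))⁻¹) * derivative^[n] ((X ^ 2 - 1) ^ n)

/-- The `m`-th derivative of the Legendre polynomial. -/
def legendreD (n m : ℕ) (x : ℝ) : ℝ :=
  (Polynomial.derivative^[m] (legendrePoly n)).eval x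

lemma iteratedDeriv_polynomial_eval (p : Polynomial ℝ) (k : ℕ) :
    iteratedDeriv k (fun x => p.eval x) = fun x => (Polynomial.derivative^[k] p).eval x := by
  induction k generalizing p with
  | zero => simp
  | succ k ih =>
    rw [iteratedDeriv_succ', Function.iterate_succ_apply, ← ih]
    congr 1
    ext x
    simp

lemma legendreP_eq_eval (n : ℕ) : legendreP n = fun x => (legendrePoly n).eval x := by
  ext x
  have h := congrFun (iteratedDeriv_polynomial_eval ((Polynomial.X ^ 2 - 1) ^ n) n) x
  simp only [Polynomial.eval_pow, Polynomial.eval_sub, Polynomial.eval_X, Polynomial.eval_one] at h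
  simp only [legendreP, legendrePoly, Polynomial.eval_mul, Polynomial.eval_C, h]

lemma iteratedDeriv_legendreP (n m : ℕ) : iteratedDeriv m (legendreP n) = legendreD n m := by
  rw [legendreP_eq_eval, iteratedDeriv_polynomial_eval]
  rfl

lemma hasDerivAt_legendreD (n m : ℕ) (x : ℝ) :
    HasDerivAt (legendreD n m) (legendreD n (m + 1) x) x := by
  unfold legendreD
  rw [Function.iterate_succ_apply']
  exact Polynomial.hasDerivAt _ x

lemma continuous_legendreD (n m : ℕ) : Continuous (legendreD n m) :=
  continuous_iff_continuousAt.2 fun x => (hasDerivAt_legendreD n m x).continuousAt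

open Polynomial in
lemma rodrigues_kernel_ode (n k : ℕ) :
    (X ^ 2 - 1) * derivative^[k + 2] ((X ^ 2 - 1 : ℝ[X]) ^ n)
      + 2 * ((k : ℝ[X]) + 1 - (n : ℝ[X])) * X * derivative^[k + 1] ((X ^ 2 - 1 : ℝ[X]) ^ n)
      + ((k : ℝ[X]) + 1) * ((k : ℝ[X]) - 2 * (n : ℝ[X])) * derivative^[k] ((X ^ 2 - 1 : ℝ[X]) ^ n) = 0 := by
  induction k with
  | zero =>
    have h1 : (X ^ 2 - 1) * derivative ((X ^ 2 - 1 : ℝ[X]) ^ n)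
        = 2 * (n : ℝ[X]) * X * (X ^ 2 - 1 : ℝ[X]) ^ n := by
      cases n with
      | zero => simp
      | succ n =>
        simp only [derivative_pow, derivative_sub, derivative_X, derivative_one]
        simp only [map_natCast, Nat.add_sub_cancel]
        push_cast
        ring
    have h2 := congrArg derivative h1
    simp only [derivative_mul, derivative_sub, derivative_X_pow, derivative_one, derivative_X,
      derivative_natCast, derivative_ofNat] at h2
    simp only [Function.iterate_succ_apply, Function.iterate_zero, id]
    push_cast at h2 ⊢
    simp only [map_ofNat] at h2
    linear_combination h2
  | succ k ih =>
    have h2 := congrArg derivative ih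
    simp only [derivative_mul, derivative_add, derivative_sub, derivative_X_pow, derivative_one,
      derivative_X, derivative_natCast, derivative_ofNat, derivative_zero,
      ← Function.iterate_succ_apply' (f := derivative)] at h2
    push_cast at h2 ⊢
    simp only [map_ofNat] at h2
    linear_combination h2

lemma legendreD_ode (n m : ℕ) (x : ℝ) :
    (1 - x ^ 2) * legendreD n (m + 2) x - 2 * (m + 1) * x * legendreD n (m + 1) x
      + ((n : ℝ) - m) * (n + m + 1) * legendreD n m x = 0 := by
  have h := congrArg (Polynomial.eval x) (rodrigues_kernel_ode n (m + n))
  simp only [legendreD, legendrePoly, Polynomial.iterate_derivative_C_mul, Polynomial.eval_mul,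
    Polynomial.eval_C, ← Function.iterate_add_apply]
  simp only [Polynomial.eval_mul, Polynomial.eval_add, Polynomial.eval_sub, Polynomial.eval_pow,
    Polynomial.eval_X, Polynomial.eval_one, Polynomial.eval_natCast, Polynomial.eval_ofNat,
    Polynomial.eval_zero] at h
  rw [show m + 2 + n = m + n + 2 by ring, show m + 1 + n = m + n + 1 by ring]
  push_cast at h
  linear_combination -((2:ℝ)^n * (Nat.factorial n : ℝ))⁻¹ * h

lemma natDegree_rodrigues_kernel (n : ℕ) :
    ((Polynomial.X ^ 2 - 1 : Polynomial ℝ) ^ n).natDegree = n * 2 := by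
  rw [Polynomial.natDegree_pow, ← Polynomial.C_1, Polynomial.natDegree_X_pow_sub_C]

lemma legendreD_self (n : ℕ) (x : ℝ) :
    legendreD n n x = ((2:ℝ)^n * (Nat.factorial n : ℝ))⁻¹ * (Nat.factorial (2 * n) : ℝ) := by
  simp only [legendreD, legendrePoly, Polynomial.iterate_derivative_C_mul, Polynomial.eval_mul,
    Polynomial.eval_C, ← Function.iterate_add_apply]
  have hm : ((Polynomial.X ^ 2 - 1 : Polynomial ℝ) ^ n).Monic := by
    apply Polynomial.Monic.pow
    rw [← Polynomial.C_1]
    exact Polynomial.monic_X_pow_sub_C _ (by norm_num)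
  have hd : (Polynomial.derivative^[n + n] ((Polynomial.X ^ 2 - 1 : Polynomial ℝ) ^ n)).natDegree
      = 0 := by
    have := Polynomial.natDegree_iterate_derivative ((Polynomial.X ^ 2 - 1 : Polynomial ℝ) ^ n)
      (n + n)
    rw [natDegree_rodrigues_kernel] at this
    omega
  rw [Polynomial.eq_C_of_natDegree_eq_zero hd, Polynomial.eval_C,
    Polynomial.coeff_iterate_derivative, zero_add, Nat.descFactorial_self,
    show n + n = n * 2 by ring, ← natDegree_rodrigues_kernel n, hm.coeff_natDegree,
    natDegree_rodrigues_kernel, mul_comm n 2]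
  simp

lemma legendreD_self_succ (n : ℕ) (x : ℝ) : legendreD n (n + 1) x = 0 := by
  have h := hasDerivAt_legendreD n n x
  rw [funext (legendreD_self n)] at h
  exact h.unique (hasDerivAt_const _ _)

lemma centralBinom_sq_mul_le (n : ℕ) :
    (2 * (n : ℝ) + 1) * ((Nat.factorial (2 * n) : ℝ) / (4 ^ n * (Nat.factorial n : ℝ) ^ 2)) ^ 2
      ≤ 1 := by
  induction n with
  | zero => simp
  | succ n ih =>
    refine le_trans (le_of_eq_of_le ?_ (mul_le_of_le_one_right
      (by positivity) (?_ : (2 * (n:ℝ) + 1) * (2 * n + 3) / (2 * n + 2) ^ 2 ≤ 1))) ih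
    · rw [show 2 * (n + 1) = 2 * n + 1 + 1 by ring, Nat.factorial_succ, Nat.factorial_succ,
        Nat.factorial_succ, pow_succ]
      have : (Nat.factorial n : ℝ) ≠ 0 := by positivity
      push_cast
      field_simp
      ring
    · rw [div_le_one (by positivity)]
      nlinarith

/-- The square of the normalising constant of `tY n m`. -/
def normSq (n m : ℕ) : ℝ :=
  ((2 * (n : ℝ) + 1) / (4 * Real.pi)) *
    ((Nat.factorial (n - m) : ℝ) / (Nat.factorial (n + m) : ℝ))

lemma normSq_nonneg (n m : ℕ) : 0 ≤ normSq n m := by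
  unfold normSq
  positivity

lemma normSq_eq_succ {n m : ℕ} (h : m < n) :
    normSq n m = ((n : ℝ) - m) * (n + m + 1) * normSq n (m + 1) := by
  obtain ⟨k, rfl⟩ := Nat.exists_eq_add_of_lt h
  unfold normSq
  rw [show m + k + 1 - m = k + 1 by omega, show m + k + 1 - (m + 1) = k by omega,
    show m + k + 1 + (m + 1) = m + k + 1 + m + 1 by ring, Nat.factorial_succ k,
    Nat.factorial_succ (m + k + 1 + m)]
  push_cast
  have := Real.pi_pos
  field_simp
  ring

/-- At the equator the derivatives of `P_n` satisfy a two-step recursion, which bounds the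
normalised values from the explicit top derivative. -/
lemma normSq_mul_legendreD_zero_bound {n : ℕ} (j : ℕ) (hj : j ≤ n) :
    (normSq n (n - j) * legendreD n (n - j) 0 ^ 2) ^ 2 * (((j : ℝ) + 1) * (2 * n - j))
      ≤ (2 * n + 1) * (2 * n) / (16 * Real.pi ^ 2) := by
  have hpi := Real.pi_pos
  induction j using Nat.twoStepInduction with
  | zero =>
    have h := centralBinom_sq_mul_le n
    have h4 : (4:ℝ) ^ n = 2 ^ n * 2 ^ n := by rw [← mul_pow]; norm_num
    have e : normSq n (n - 0) * legendreD n (n - 0) 0 ^ 2 = (2 * n + 1) / (4 * Real.pi) *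
        ((Nat.factorial (2 * n) : ℝ) / (4 ^ n * (Nat.factorial n : ℝ) ^ 2)) := by
      rw [Nat.sub_zero, legendreD_self, normSq, ← two_mul, Nat.sub_self, h4]
      have : (Nat.factorial n : ℝ) ≠ 0 := by positivity
      have : (Nat.factorial (2 * n) : ℝ) ≠ 0 := by positivity
      field_simp
      simp
    rw [e]
    set z := (Nat.factorial (2 * n) : ℝ) / (4 ^ n * (Nat.factorial n : ℝ) ^ 2)
    calc ((2 * n + 1) / (4 * Real.pi) * z) ^ 2 * (((0 : ℕ) + 1) * (2 * n - (0 : ℕ)))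
        = (2 * n + 1) * (2 * n) / (16 * Real.pi ^ 2) * ((2 * n + 1) * z ^ 2) := by
          push_cast; field_simp; ring
      _ ≤ _ := mul_le_of_le_one_right (by positivity) h
  | one =>
    have hD : legendreD n (n - 1) 0 = 0 := by
      have h := legendreD_ode n (n - 1) 0
      rw [show n - 1 + 2 = n + 1 by omega, legendreD_self_succ] at h
      push_cast [Nat.cast_sub hj] at h
      have h1 : (1:ℝ) ≤ n := by exact_mod_cast hj
      have h2 : (2 * (n:ℝ)) * legendreD n (n - 1) 0 = 0 := by linear_combination h
      rcases mul_eq_zero.1 h2 with h3 | h3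
      · linarith
      · exact h3
    rw [hD]
    simp only [ne_eq, OfNat.ofNat_ne_zero, not_false_eq_true, zero_pow, mul_zero, zero_mul]
    positivity
  | more j ih _ =>
    refine le_trans ?_ (ih (by omega))
    obtain ⟨m, rfl⟩ := Nat.exists_eq_add_of_le hj
    have e1 : j + 2 + m - (j + 2) = m := by omega
    have e2 : j + 2 + m - j = m + 2 := by omega
    rw [e1, e2, normSq_eq_succ (show m < j + 2 + m by omega),
      normSq_eq_succ (show m + 1 < j + 2 + m by omega)]
    have h := legendreD_ode (j + 2 + m) m 0
    set d2 := legendreD (j + 2 + m) (m + 2) 0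
    set d0 := legendreD (j + 2 + m) m 0
    set K := normSq (j + 2 + m) (m + 1 + 1)
    push_cast at h ⊢
    have h' : d2 = -(((j:ℝ) + 2) * (j + 2 * m + 3) * d0) := by linear_combination h
    rw [h']
    have hj0 : (0:ℝ) ≤ j := j.cast_nonneg
    have hm0 : (0:ℝ) ≤ m := m.cast_nonneg
    have key : (((j:ℝ) + 1) * (j + 2 * m + 4)) ^ 2 * ((j + 3) * (j + 2 * m + 2)) ≤
        (((j:ℝ) + 2) * (j + 2 * m + 3)) ^ 2 * ((j + 1) * (j + 2 * m + 4)) := by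
      have k1 : ((j:ℝ) + 1) * (j + 3) ≤ (j + 2) ^ 2 := by nlinarith
      have k2 : ((j:ℝ) + 2 * m + 4) * (j + 2 * m + 2) ≤ (j + 2 * m + 3) ^ 2 := by nlinarith
      have := mul_le_mul k1 k2 (by positivity) (by positivity)
      have := mul_le_mul_of_nonneg_right this
        (show 0 ≤ ((j:ℝ) + 1) * (j + 2 * m + 4) by positivity)
      linarith
    have := mul_le_mul_of_nonneg_left key
      (show 0 ≤ (K * (((j:ℝ) + 2) * (j + 2 * m + 3)) * d0 ^ 2) ^ 2 by positivity)
    linarith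

lemma normSq_mul_legendreD_zero_le {n m : ℕ} (h : m ≤ n) :
    (normSq n m * legendreD n m 0 ^ 2) ^ 2 * (((n : ℝ) - m + 1) * (n + m))
      ≤ n * (n + 1) / 16 := by
  have := normSq_mul_legendreD_zero_bound (n := n) (n - m) (Nat.sub_le _ _)
  rw [Nat.sub_sub_self h] at this
  push_cast [Nat.cast_sub h] at this
  have hn : (0:ℝ) ≤ n := n.cast_nonneg
  have hpi := Real.pi_gt_three
  calc _ = (normSq n m * legendreD n m 0 ^ 2) ^ 2 * (((n : ℝ) - m + 1) * (2 * n - (n - m))) := by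
        ring
    _ ≤ _ := this
    _ ≤ _ := by
        rw [div_le_div_iff₀ (by positivity) (by positivity)]
        nlinarith [mul_nonneg hn hn, mul_nonneg hn (show 0 ≤ Real.pi ^ 2 - 9 by nlinarith),
          mul_nonneg (mul_nonneg hn hn) (show 0 ≤ Real.pi ^ 2 - 9 by nlinarith)]

/-- Energy of the normalised associated Legendre function at the equator. -/
lemma equator_energy_le {n m : ℕ} (h : m ≤ n) (hn : 1 ≤ n) {η : ℝ} (hη0 : 0 ≤ η) (hη : η < 1)
    (hm : (m : ℝ) ^ 2 ≤ η * (n * (n + 1))) :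
    normSq n m * legendreD n (m + 1) 0 ^ 2
      + n * (n + 1) * (normSq n m * legendreD n m 0 ^ 2) ≤ 2 / (1 - η) * (n * (n + 1)) := by
  have hn1 : (1:ℝ) ≤ n := by exact_mod_cast hn
  have hm0 : (0:ℝ) ≤ m := m.cast_nonneg
  have hmn : (m:ℝ) ≤ n := by exact_mod_cast h
  set Λ : ℝ := n * (n + 1) with hΛ
  have hΛ0 : 0 < Λ := by positivity
  have h1η : 0 < 1 - η := by linarith
  have hinv : 1 ≤ 1 / (1 - η) := by rw [le_div_iff₀ h1η]; linarith
  have hA := normSq_mul_legendreD_zero_le h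
  have hu : normSq n m * legendreD n m 0 ^ 2 ≤ 1 / (1 - η) := by
    set A := normSq n m * legendreD n m 0 ^ 2
    have h2 : A ^ 2 * ((1 - η) * Λ) ≤ Λ := by
      have : (1 - η) * Λ ≤ ((n : ℝ) - m + 1) * (n + m) := by rw [hΛ] at hm ⊢; nlinarith
      have := mul_le_mul_of_nonneg_left this (sq_nonneg A)
      linarith
    have h3 : A ^ 2 ≤ 1 / (1 - η) := by
      rw [le_div_iff₀ h1η]
      refine le_of_mul_le_mul_right ?_ hΛ0
      linarith
    refine abs_le_of_sq_le_sq' ?_ (by positivity) |>.2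
    nlinarith
  have hv : normSq n m * legendreD n (m + 1) 0 ^ 2 ≤ Λ := by
    rcases h.eq_or_lt with rfl | hlt
    · rw [legendreD_self_succ]; simp [hΛ0.le]
    · have hA' := normSq_mul_legendreD_zero_le (Nat.succ_le_of_lt hlt)
      rw [normSq_eq_succ hlt]
      have hmn' : (m:ℝ) + 1 ≤ n := by exact_mod_cast hlt
      push_cast at hA'
      simp only [Nat.succ_eq_add_one] at hA'
      set A := normSq n (m + 1) * legendreD n (m + 1) 0 ^ 2 with hAdef
      set g := ((n : ℝ) - m) * (n + m + 1) with hg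
      have hg0 : 0 ≤ g := mul_nonneg (by linarith) (by linarith)
      have hgΛ : g ≤ Λ := by rw [hg, hΛ]; nlinarith
      have : g * normSq n (m + 1) * legendreD n (m + 1) 0 ^ 2 = g * A := by rw [hAdef]; ring
      rw [this]
      refine abs_le_of_sq_le_sq' ?_ hΛ0.le |>.2
      have h5 : A ^ 2 * g ≤ Λ := by
        have : A ^ 2 * g = A ^ 2 * ((n - (m + 1) + 1) * (n + (m + 1))) := by rw [hg]; ring
        linarith
      nlinarith
  have : 2 / (1 - η) * Λ = 1 / (1 - η) * Λ + Λ * (1 / (1 - η)) := by ring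
  have h6 := mul_le_mul_of_nonneg_left hu hΛ0.le
  nlinarith

lemma legendreD_one (n j : ℕ) (hj : j ≤ n) :
    legendreD n (n - j) 1 * (2 ^ (n - j) * (Nat.factorial (n - j) : ℝ) * (Nat.factorial j : ℝ))
      = (Nat.factorial (2 * n - j) : ℝ) := by
  induction j with
  | zero =>
    rw [Nat.sub_zero, legendreD_self]
    have : (Nat.factorial n : ℝ) ≠ 0 := by positivity
    field_simp
    simp
  | succ j ih =>
    obtain ⟨m, rfl⟩ := Nat.exists_eq_add_of_le hj
    have ih := ih (by omega)
    have e1 : j + 1 + m - (j + 1) = m := by omega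
    have e2 : j + 1 + m - j = m + 1 := by omega
    have e3 : 2 * (j + 1 + m) - j = j + 2 * m + 1 + 1 := by omega
    have e4 : 2 * (j + 1 + m) - (j + 1) = j + 2 * m + 1 := by omega
    rw [e2, e3, Nat.factorial_succ (j + 2 * m + 1), Nat.factorial_succ m, pow_succ] at ih
    rw [e1, e4, Nat.factorial_succ j]
    have h := legendreD_ode (j + 1 + m) m 1
    push_cast at h ih ⊢
    refine mul_left_cancel₀ (show ((j:ℝ) + 2 * m + 1 + 1) ≠ 0 by positivity) ?_
    linear_combination ih + (2 ^ m * (Nat.factorial m : ℝ) * (Nat.factorial j : ℝ)) * h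

lemma legendreD_zero_one (n : ℕ) : legendreD n 0 1 = 1 := by
  have h := legendreD_one n n le_rfl
  rw [Nat.sub_self, two_mul, Nat.add_sub_cancel] at h
  have : (Nat.factorial n : ℝ) ≠ 0 := by positivity
  simpa [this] using h

/-- `u` solves `u'' + (Λ (1 - x²) - m²) u = 0` on `[0, 1)` with respect to the derivation
`(1 - x²) d/dx`, `V` is its derivative, and both vanish at `1`. -/
structure IsLegendreSol (Λ m : ℝ) (u V : ℝ → ℝ) : Prop where
  hasDerivAt_u : ∀ x ∈ Ico (0:ℝ) 1, HasDerivAt u (V x / (1 - x ^ 2)) x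
  hasDerivAt_V : ∀ x ∈ Ico (0:ℝ) 1,
    HasDerivAt V (-((Λ * (1 - x ^ 2) - m ^ 2) * u x) / (1 - x ^ 2)) x
  continuous_u : Continuous u
  continuous_V : Continuous V
  u_one : u 1 = 0
  V_one : V 1 = 0

lemma antitoneOn_of_hasDerivAt_nonpos {f f' : ℝ → ℝ} {a b : ℝ} (hc : ContinuousOn f (Icc a b))
    (hd : ∀ x ∈ Ioo a b, HasDerivAt f (f' x) x) (hf : ∀ x ∈ Ioo a b, f' x ≤ 0) :
    AntitoneOn f (Icc a b) := by
  apply antitoneOn_of_hasDerivWithinAt_nonpos (convex_Icc a b) hc (f' := f')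
  · intro x hx
    rw [interior_Icc] at hx
    exact (hd x hx).hasDerivWithinAt
  · intro x hx
    rw [interior_Icc] at hx
    exact hf x hx

lemma one_sub_sq_pos {x : ℝ} (hx : x ∈ Ico (0:ℝ) 1) : 0 < 1 - x ^ 2 := by
  nlinarith [hx.1, hx.2]

namespace IsLegendreSol

variable {Λ m : ℝ} {u V : ℝ → ℝ}

lemma energy_antitoneOn (h : IsLegendreSol Λ m u V) (hΛ : 0 ≤ Λ) :
    AntitoneOn (fun x => V x ^ 2 + (Λ * (1 - x ^ 2) - m ^ 2) * u x ^ 2) (Icc 0 1) := by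
  have hu := h.continuous_u
  have hV := h.continuous_V
  refine antitoneOn_of_hasDerivAt_nonpos (f' := fun x => -(2 * Λ * x * u x ^ 2))
    (by fun_prop) (fun x hx => ?_) (fun x hx => ?_)
  · have hx' : x ∈ Ico (0:ℝ) 1 := ⟨hx.1.le, hx.2⟩
    have hp := (one_sub_sq_pos hx').ne'
    have h1 := ((h.hasDerivAt_V x hx').pow 2).add
      (((((hasDerivAt_id x).pow 2).const_sub 1).const_mul Λ |>.sub_const (m ^ 2)).mul
        ((h.hasDerivAt_u x hx').pow 2))
    refine h1.congr_deriv ?_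
    simp only [Pi.pow_apply, id]
    push_cast
    field_simp
    ring
  · have := hx.1
    have : 0 ≤ 2 * Λ * x * u x ^ 2 := by positivity
    linarith

/-- The Wronskian-corrected WKB energy, before normalisation, for the potential
`q - m²` regularised by `c`. -/
def wkbEnergy (Λ m c : ℝ) (u V : ℝ → ℝ) (x : ℝ) : ℝ :=
  V x ^ 2 - x * (Λ * (1 - x ^ 2) / (Λ * (1 - x ^ 2) - m ^ 2 + c)) * (u x * V x)
    + (Λ * (1 - x ^ 2) - m ^ 2
      + 3 / 2 * x ^ 2 * (Λ * (1 - x ^ 2) / (Λ * (1 - x ^ 2) - m ^ 2 + c)) ^ 2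
      - (3 * x ^ 2 - 1) / 2 * (Λ * (1 - x ^ 2) / (Λ * (1 - x ^ 2) - m ^ 2 + c))) * u x ^ 2

lemma hasDerivAt_wkbEnergy (h : IsLegendreSol Λ m u V) {c x : ℝ} (hx : x ∈ Ico (0:ℝ) 1)
    (hR : 0 < Λ * (1 - x ^ 2) - m ^ 2 + c) :
    HasDerivAt (fun y => wkbEnergy Λ m c u V y / √(Λ * (1 - y ^ 2) - m ^ 2 + c))
      (Λ * x / (Λ * (1 - x ^ 2) - m ^ 2 + c) / √(Λ * (1 - x ^ 2) - m ^ 2 + c) * u x ^ 2 *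
        (-2 * c + 15 / 2 * x ^ 2 * (Λ * (1 - x ^ 2) / (Λ * (1 - x ^ 2) - m ^ 2 + c)) ^ 2
          - 9 / 2 * (3 * x ^ 2 - 1) * (Λ * (1 - x ^ 2) / (Λ * (1 - x ^ 2) - m ^ 2 + c))
          - 2 * (2 - 3 * x ^ 2))) x := by
  have hp := one_sub_sq_pos hx
  set p := 1 - x ^ 2 with hpdef
  set R := Λ * p - m ^ 2 + c with hRdef
  have hRx : HasDerivAt (fun y : ℝ => Λ * (1 - y ^ 2) - m ^ 2 + c) (-(2 * Λ * x)) x := by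
    have := ((((hasDerivAt_id x).pow 2).const_sub 1).const_mul Λ |>.sub_const (m ^ 2)).add_const c
    exact this.congr_deriv (by simp; ring)
  have hq : HasDerivAt (fun y : ℝ => Λ * (1 - y ^ 2)) (-(2 * Λ * x)) x := by
    have := (((hasDerivAt_id x).pow 2).const_sub 1).const_mul Λ
    exact this.congr_deriv (by simp; ring)
  have ha := hq.div hRx hR.ne'
  have hu := h.hasDerivAt_u x hx
  have hV := h.hasDerivAt_V x hx
  have hx1 := hasDerivAt_id x
  have hH := ((hV.pow 2).sub ((hx1.mul ha).mul (hu.mul hV))).add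
    ((((hq.sub_const (m ^ 2)).add (((hx1.pow 2).const_mul (3 / 2)).mul (ha.pow 2))).sub
      (((((hx1.pow 2).const_mul 3).sub_const 1).div_const 2).mul ha)).mul (hu.pow 2))
  have hE := hH.div (hRx.sqrt hR.ne') (Real.sqrt_pos.2 hR).ne'
  refine hE.congr_deriv ?_
  have hs := Real.sqrt_pos.2 hR
  have hs2 : √R ^ 2 = R := Real.sq_sqrt hR.le
  simp only [Pi.pow_apply, Pi.add_apply, Pi.sub_apply, Pi.mul_apply, Pi.div_apply, id, ← hpdef,
    ← hRdef]
  generalize √R = s at hs hs2 ⊢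
  have hc : c = R - Λ * p + m ^ 2 := by rw [hRdef]; ring
  clear_value R p
  subst hc
  subst hs2
  push_cast
  field_simp
  rw [hpdef]
  ring

lemma potential_antitone {Λ m x y : ℝ} (hΛ : 0 ≤ Λ) (hx : 0 ≤ x) (hxy : x ≤ y) :
    Λ * (1 - y ^ 2) - m ^ 2 ≤ Λ * (1 - x ^ 2) - m ^ 2 := by
  have : x ^ 2 ≤ y ^ 2 := by gcongr
  nlinarith

lemma potential_ratio_le {Λ m r x : ℝ} (hr : 1 ≤ r) (hm : m ^ 2 = r ^ 6)
    (hQ : 16 * r ^ 4 ≤ Λ * (1 - x ^ 2) - m ^ 2) :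
    Λ * (1 - x ^ 2) / (Λ * (1 - x ^ 2) - m ^ 2 + 16 * r ^ 4) ≤ 33 / 32 * r ^ 2 := by
  have hr4 : 1 ≤ r ^ 4 := one_le_pow₀ hr
  have hr2 : 1 ≤ r ^ 2 := one_le_pow₀ hr
  rw [div_le_iff₀ (by linarith)]
  rw [hm] at *
  set R := Λ * (1 - x ^ 2) - r ^ 6 + 16 * r ^ 4 with hR
  have h1 : 32 * r ^ 4 ≤ R := by linarith
  have h2 : 32 * r ^ 6 ≤ r ^ 2 * R := by
    have := mul_le_mul_of_nonneg_left h1 (sq_nonneg r)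
    linarith
  have h3 : R ≤ r ^ 2 * R := le_mul_of_one_le_left (by linarith) hr2
  have h4 : Λ * (1 - x ^ 2) = R + r ^ 6 - 16 * r ^ 4 := by rw [hR]; ring
  rw [h4]
  linarith

lemma wkbEnergy_antitoneOn (h : IsLegendreSol Λ m u V) {r x : ℝ} (hΛ : 0 < Λ) (hr : 1 ≤ r)
    (hm : m ^ 2 = r ^ 6) (hx : x ∈ Ico (0:ℝ) 1) (hQ : 16 * r ^ 4 ≤ Λ * (1 - x ^ 2) - m ^ 2) :
    AntitoneOn (fun y => wkbEnergy Λ m (16 * r ^ 4) u V y /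
      √(Λ * (1 - y ^ 2) - m ^ 2 + 16 * r ^ 4)) (Icc 0 x) := by
  have hr4 : 1 ≤ r ^ 4 := one_le_pow₀ hr
  have hr2 : 1 ≤ r ^ 2 := one_le_pow₀ hr
  have hQy : ∀ y ∈ Icc 0 x, 16 * r ^ 4 ≤ Λ * (1 - y ^ 2) - m ^ 2 := fun y hy =>
    hQ.trans (potential_antitone hΛ.le hy.1 hy.2)
  have hI : ∀ y ∈ Icc 0 x, y ∈ Ico (0:ℝ) 1 := fun y hy => ⟨hy.1, hy.2.trans_lt hx.2⟩
  have hd := fun y (hy : y ∈ Icc 0 x) => h.hasDerivAt_wkbEnergy (c := 16 * r ^ 4) (hI y hy)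
    (by linarith [hQy y hy])
  refine antitoneOn_of_hasDerivAt_nonpos (fun y hy => (hd y hy).continuousAt.continuousWithinAt)
    (fun y hy => hd y (Ioo_subset_Icc_self hy)) (fun y hy => ?_)
  have hy := Ioo_subset_Icc_self hy
  have hQ' := hQy y hy
  have hR : 0 < Λ * (1 - y ^ 2) - m ^ 2 + 16 * r ^ 4 := by linarith
  have hy0 := hy.1
  have hy1 : y ^ 2 ≤ 1 := by nlinarith [(hI y hy).2]
  have hp := one_sub_sq_pos (hI y hy)
  have ha := potential_ratio_le hr hm hQ'
  have ha0 : 0 ≤ Λ * (1 - y ^ 2) / (Λ * (1 - y ^ 2) - m ^ 2 + 16 * r ^ 4) := by positivity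
  set a := Λ * (1 - y ^ 2) / (Λ * (1 - y ^ 2) - m ^ 2 + 16 * r ^ 4)
  refine mul_nonpos_of_nonneg_of_nonpos (by positivity) ?_
  have h1 : a ^ 2 ≤ (33 / 32 * r ^ 2) ^ 2 := by gcongr
  have h2 : y ^ 2 * a ^ 2 ≤ a ^ 2 := mul_le_of_le_one_left (sq_nonneg a) hy1
  have h3 : 0 ≤ y ^ 2 * a := by positivity
  have h4 : r ^ 2 ≤ r ^ 4 := pow_le_pow_right₀ hr (by norm_num)
  have h5 : (33 / 32 * r ^ 2) ^ 2 = 1089 / 1024 * r ^ 4 := by ring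
  nlinarith

lemma energy_le_wkbEnergy {r x : ℝ} (hΛ : 0 < Λ) (hr : 1 ≤ r)
    (hm : m ^ 2 = r ^ 6) (hx : x ∈ Ico (0:ℝ) 1) (hQ : 16 * r ^ 4 ≤ Λ * (1 - x ^ 2) - m ^ 2) :
    V x ^ 2 + (Λ * (1 - x ^ 2) - m ^ 2) * u x ^ 2 ≤ 3 * wkbEnergy Λ m (16 * r ^ 4) u V x := by
  have hp := one_sub_sq_pos hx
  have hr4 : 1 ≤ r ^ 4 := one_le_pow₀ hr
  have hr2 : 1 ≤ r ^ 2 := one_le_pow₀ hr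
  have ha := potential_ratio_le hr hm hQ
  have hR : 0 < Λ * (1 - x ^ 2) - m ^ 2 + 16 * r ^ 4 := by linarith
  have ha0 : 0 ≤ Λ * (1 - x ^ 2) / (Λ * (1 - x ^ 2) - m ^ 2 + 16 * r ^ 4) := by positivity
  unfold wkbEnergy
  set a := Λ * (1 - x ^ 2) / (Λ * (1 - x ^ 2) - m ^ 2 + 16 * r ^ 4)
  set Q := Λ * (1 - x ^ 2) - m ^ 2
  have h4 : r ^ 2 ≤ r ^ 4 := pow_le_pow_right₀ hr (by norm_num)
  have hx1 : x ^ 2 ≤ 1 := by linarith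
  have haQ : a ≤ Q / 2 := by linarith
  have ha2 : a ^ 2 ≤ Q := by
    have : a ^ 2 ≤ (33 / 32 * r ^ 2) ^ 2 := by gcongr
    have h5 : (33 / 32 * r ^ 2) ^ 2 = 1089 / 1024 * r ^ 4 := by ring
    linarith
  have h6 : (3 * x ^ 2 - 1) / 2 * a ≤ Q / 2 := by nlinarith
  have h7 : x ^ 2 * a ^ 2 ≤ Q := (mul_le_of_le_one_left (sq_nonneg a) hx1).trans ha2
  have h8 := mul_le_mul_of_nonneg_right h6 (sq_nonneg (u x))
  have h9 := mul_le_mul_of_nonneg_right h7 (sq_nonneg (u x))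
  have h10 : 0 ≤ x ^ 2 * a ^ 2 * u x ^ 2 := by positivity
  nlinarith [sq_nonneg (V x - 3 / 4 * x * a * u x)]

lemma energy_allowed_le (h : IsLegendreSol Λ m u V) {r x : ℝ} (hΛ : 0 < Λ) (hr : 1 ≤ r)
    (hm : m ^ 2 = r ^ 6) (hx : x ∈ Icc (0:ℝ) 1) (hQ : 16 * r ^ 4 ≤ Λ * (1 - x ^ 2) - m ^ 2) :
    (V x ^ 2 + (Λ * (1 - x ^ 2) - m ^ 2) * u x ^ 2) * √(Λ - m ^ 2) ≤
      9 * √(Λ * (1 - x ^ 2) - m ^ 2) * (V 0 ^ 2 + Λ * u 0 ^ 2) := by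
  have hr4 : 1 ≤ r ^ 4 := one_le_pow₀ hr
  have hx' : x ∈ Ico (0:ℝ) 1 := by
    refine ⟨hx.1, lt_of_le_of_ne hx.2 ?_⟩
    rintro rfl
    nlinarith [sq_nonneg m]
  have h1 := energy_le_wkbEnergy (u := u) (V := V) hΛ hr hm hx' hQ
  have h2 := h.wkbEnergy_antitoneOn hΛ hr hm hx' hQ (left_mem_Icc.2 hx.1)
    (right_mem_Icc.2 hx.1) hx.1
  have hQ0 := hQ.trans (potential_antitone (m := m) hΛ.le le_rfl hx.1)
  have h3 : wkbEnergy Λ m (16 * r ^ 4) u V 0 ≤ V 0 ^ 2 + 2 * Λ * u 0 ^ 2 := by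
    unfold wkbEnergy
    have : Λ * (1 - 0 ^ 2) / (Λ * (1 - 0 ^ 2) - m ^ 2 + 16 * r ^ 4) ≤ Λ := by
      rw [show Λ * (1 - 0 ^ 2) = Λ by ring] at hQ0 ⊢
      exact div_le_self hΛ.le (by linarith)
    set a := Λ * (1 - 0 ^ 2) / (Λ * (1 - 0 ^ 2) - m ^ 2 + 16 * r ^ 4)
    have h4 := mul_le_mul_of_nonneg_right this (sq_nonneg (u 0))
    have h5 : 0 ≤ m ^ 2 * u 0 ^ 2 := by positivity
    have h6 : 0 ≤ Λ * u 0 ^ 2 := by positivity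
    linarith
  set Q := Λ * (1 - x ^ 2) - m ^ 2
  have hQ0' : Λ * (1 - 0 ^ 2) - m ^ 2 = Λ - m ^ 2 := by ring
  simp only [hQ0'] at h2 hQ0
  have hs0 : 0 < √(Λ - m ^ 2 + 16 * r ^ 4) := Real.sqrt_pos.2 (by linarith)
  have hsx : 0 < √(Q + 16 * r ^ 4) := Real.sqrt_pos.2 (by linarith)
  rw [div_le_div_iff₀ hsx hs0] at h2
  have hs1 : √(Λ - m ^ 2) ≤ √(Λ - m ^ 2 + 16 * r ^ 4) := Real.sqrt_le_sqrt (by linarith)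
  have hs2 : √(Q + 16 * r ^ 4) ≤ 3 / 2 * √Q := by
    rw [Real.sqrt_le_left (by positivity), mul_pow, Real.sq_sqrt (by linarith)]
    linarith
  have hE : 0 ≤ V 0 ^ 2 + Λ * u 0 ^ 2 := by positivity
  have hH : 0 ≤ wkbEnergy Λ m (16 * r ^ 4) u V x := by
    have : 0 ≤ V x ^ 2 + Q * u x ^ 2 := add_nonneg (sq_nonneg _)
      (mul_nonneg (by linarith) (sq_nonneg _))
    linarith
  calc (V x ^ 2 + Q * u x ^ 2) * √(Λ - m ^ 2)
      ≤ 3 * wkbEnergy Λ m (16 * r ^ 4) u V x * √(Λ - m ^ 2 + 16 * r ^ 4) := by gcongr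
    _ = 3 * (wkbEnergy Λ m (16 * r ^ 4) u V x * √(Λ - m ^ 2 + 16 * r ^ 4)) := by ring
    _ ≤ 3 * (wkbEnergy Λ m (16 * r ^ 4) u V 0 * √(Q + 16 * r ^ 4)) := by gcongr
    _ ≤ 3 * (2 * (V 0 ^ 2 + Λ * u 0 ^ 2) * (3 / 2 * √Q)) := by
        gcongr
        nlinarith [sq_nonneg (V 0)]
    _ = _ := by ring

lemma mul_nonpos_of_forbidden (h : IsLegendreSol Λ m u V) (hΛ : 0 ≤ Λ) {z : ℝ} (hz : 0 ≤ z)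
    (hQ : Λ * (1 - z ^ 2) - m ^ 2 ≤ 0) {x : ℝ} (hx : x ∈ Icc z 1) : u x * V x ≤ 0 := by
  have hu := h.continuous_u
  have hV := h.continuous_V
  have hanti : AntitoneOn (fun x => -(u x * V x)) (Icc z 1) := by
    refine antitoneOn_of_hasDerivAt_nonpos
      (f' := fun x => -((V x ^ 2 - (Λ * (1 - x ^ 2) - m ^ 2) * u x ^ 2) / (1 - x ^ 2)))
      (by fun_prop) (fun y hy => ?_) (fun y hy => ?_)
    · have hy' : y ∈ Ico (0:ℝ) 1 := ⟨hz.trans hy.1.le, hy.2⟩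
      refine ((h.hasDerivAt_u y hy').mul (h.hasDerivAt_V y hy')).neg.congr_deriv ?_
      ring
    · have hy' : y ∈ Ico (0:ℝ) 1 := ⟨hz.trans hy.1.le, hy.2⟩
      have hp := one_sub_sq_pos hy'
      have hQy := (potential_antitone (m := m) hΛ hz hy.1.le).trans hQ
      rw [neg_nonpos]
      refine div_nonneg ?_ hp.le
      nlinarith [sq_nonneg (V y), sq_nonneg (u y)]
  have := hanti hx (right_mem_Icc.2 (hx.1.trans hx.2)) hx.2
  simp only [h.u_one, zero_mul, neg_zero] at this
  linarith

lemma sq_antitoneOn_of_forbidden (h : IsLegendreSol Λ m u V) (hΛ : 0 ≤ Λ) {z : ℝ} (hz : 0 ≤ z)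
    (hQ : Λ * (1 - z ^ 2) - m ^ 2 ≤ 0) : AntitoneOn (fun x => u x ^ 2) (Icc z 1) := by
  have hu := h.continuous_u
  refine antitoneOn_of_hasDerivAt_nonpos (f' := fun x => 2 * (u x * V x) / (1 - x ^ 2))
    (by fun_prop) (fun y hy => ?_) (fun y hy => ?_)
  · have hy' : y ∈ Ico (0:ℝ) 1 := ⟨hz.trans hy.1.le, hy.2⟩
    refine ((h.hasDerivAt_u y hy').pow 2).congr_deriv ?_
    push_cast
    ring
  · have hy' : y ∈ Ico (0:ℝ) 1 := ⟨hz.trans hy.1.le, hy.2⟩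
    refine div_nonpos_of_nonpos_of_nonneg ?_ (one_sub_sq_pos hy').le
    linarith [h.mul_nonpos_of_forbidden hΛ hz hQ (Ioo_subset_Icc_self hy)]

lemma sq_deriv_antitoneOn_of_forbidden (h : IsLegendreSol Λ m u V) (hΛ : 0 ≤ Λ) {z : ℝ}
    (hz : 0 ≤ z) (hQ : Λ * (1 - z ^ 2) - m ^ 2 ≤ 0) : AntitoneOn (fun x => V x ^ 2) (Icc z 1) := by
  have hV := h.continuous_V
  refine antitoneOn_of_hasDerivAt_nonpos
    (f' := fun x => 2 * (-(Λ * (1 - x ^ 2) - m ^ 2)) * (u x * V x) / (1 - x ^ 2))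
    (by fun_prop) (fun y hy => ?_) (fun y hy => ?_)
  · have hy' : y ∈ Ico (0:ℝ) 1 := ⟨hz.trans hy.1.le, hy.2⟩
    refine ((h.hasDerivAt_V y hy').pow 2).congr_deriv ?_
    push_cast
    ring
  · have hy' : y ∈ Ico (0:ℝ) 1 := ⟨hz.trans hy.1.le, hy.2⟩
    have hQy := (potential_antitone (m := m) hΛ hz hy.1.le).trans hQ
    refine div_nonpos_of_nonpos_of_nonneg ?_ (one_sub_sq_pos hy').le
    exact mul_nonpos_of_nonneg_of_nonpos (by linarith)
      (h.mul_nonpos_of_forbidden hΛ hz hQ (Ioo_subset_Icc_self hy))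

lemma energy_nonneg (h : IsLegendreSol Λ m u V) (hΛ : 0 ≤ Λ) {x : ℝ} (hx : x ∈ Icc (0:ℝ) 1) :
    0 ≤ V x ^ 2 + (Λ * (1 - x ^ 2) - m ^ 2) * u x ^ 2 := by
  have := h.energy_antitoneOn hΛ hx (right_mem_Icc.2 zero_le_one) hx.2
  simpa [h.u_one, h.V_one] using this

/-- Bounds across the turning point and in the forbidden region, deduced from the energy at the
edge of the allowed region. -/
lemma turning_point_bounds (h : IsLegendreSol Λ m u V) {r D δ : ℝ} (hΛ : 0 < Λ) (hr : 1 ≤ r)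
    (hm : m ^ 2 = r ^ 6) (hD : 0 ≤ D) (hδ : 0 < δ) (hδΛ : δ * Λ + 16 * r ^ 4 + m ^ 2 ≤ Λ)
    (hA : ∀ x ∈ Icc (0:ℝ) 1, 16 * r ^ 4 ≤ Λ * (1 - x ^ 2) - m ^ 2 →
      V x ^ 2 + (Λ * (1 - x ^ 2) - m ^ 2) * u x ^ 2 ≤ D * √(Λ * (1 - x ^ 2) - m ^ 2))
    {x : ℝ} (hx : x ∈ Icc (0:ℝ) 1) :
    (Λ * (1 - x ^ 2) - m ^ 2 ≤ 16 * r ^ 4 → r ^ 2 * u x ^ 2 ≤ D * (1 / 2 + 2048 / δ)) ∧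
    (Λ * (1 - x ^ 2) - m ^ 2 ≤ 0 → -(Λ * (1 - x ^ 2) - m ^ 2) * u x ^ 2 ≤ 4 * D * r ^ 2) := by
  have hr0 : 0 < r := by linarith
  have hr4 : 1 ≤ r ^ 4 := one_le_pow₀ hr
  have hr6 : 1 ≤ r ^ 6 := one_le_pow₀ hr
  -- the edge `y` of the allowed region and the turning point `z`
  set y := √(1 - (m ^ 2 + 16 * r ^ 4) / Λ) with hy
  set z := √(1 - m ^ 2 / Λ) with hz
  have e1 : δ ≤ 1 - (m ^ 2 + 16 * r ^ 4) / Λ := by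
    rw [le_sub_comm, div_le_iff₀ hΛ]
    linarith
  have e2 : δ ≤ 1 - m ^ 2 / Λ := by
    rw [le_sub_comm, div_le_iff₀ hΛ]
    linarith
  have hy2 : y ^ 2 = 1 - (m ^ 2 + 16 * r ^ 4) / Λ := Real.sq_sqrt (by linarith)
  have hz2 : z ^ 2 = 1 - m ^ 2 / Λ := Real.sq_sqrt (by linarith)
  have hy0 : 0 < y := Real.sqrt_pos.2 (by linarith)
  have hz0 : 0 < z := Real.sqrt_pos.2 (by linarith)
  have hQy : Λ * (1 - y ^ 2) - m ^ 2 = 16 * r ^ 4 := by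
    rw [hy2]; field_simp; ring
  have hQz : Λ * (1 - z ^ 2) - m ^ 2 = 0 := by
    rw [hz2]; field_simp; ring
  have hzy : z ^ 2 - y ^ 2 = 16 * r ^ 4 / Λ := by
    rw [hy2, hz2]; field_simp; ring
  have hyz : y ≤ z := by
    apply Real.sqrt_le_sqrt
    gcongr
    have : 0 ≤ r ^ 4 := by positivity
    linarith
  have hz1 : z < 1 := by
    have : 0 < m ^ 2 / Λ := div_pos (by linarith) hΛ
    nlinarith
  have hyI : y ∈ Icc (0:ℝ) 1 := ⟨hy0.le, by linarith⟩
  have hzI : z ∈ Icc (0:ℝ) 1 := ⟨hz0.le, hz1.le⟩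
  have hEy : V y ^ 2 + 16 * r ^ 4 * u y ^ 2 ≤ 4 * D * r ^ 2 := by
    have := hA y hyI hQy.ge
    rw [hQy, show 16 * r ^ 4 = (4 * r ^ 2) ^ 2 by ring, Real.sqrt_sq (by positivity)] at this
    calc _ = V y ^ 2 + (4 * r ^ 2) ^ 2 * u y ^ 2 := by ring
      _ ≤ _ := this
      _ = _ := by ring
  have hVmid : ∀ w ∈ Icc y z, V w ^ 2 ≤ 4 * D * r ^ 2 := fun w hw => by
    have h1 := h.energy_antitoneOn hΛ.le hyI ⟨hy0.le.trans hw.1, hw.2.trans hz1.le⟩ hw.1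
    have h2 := potential_antitone (m := m) hΛ.le (hy0.le.trans hw.1) hw.2
    simp only [hQy] at h1
    rw [hQz] at h2
    have := mul_nonneg h2 (sq_nonneg (u w))
    linarith
  have huy : u y ^ 2 ≤ D / (4 * r ^ 2) := by
    rw [le_div_iff₀ (by positivity)]
    have h1 : 16 * r ^ 4 * u y ^ 2 ≤ 4 * D * r ^ 2 := by linarith [sq_nonneg (V y)]
    have h2 : 0 < 4 * r ^ 2 := by positivity
    refine le_of_mul_le_mul_right ?_ h2
    linarith
  have humid : ∀ w ∈ Icc y z, r ^ 2 * u w ^ 2 ≤ D * (1 / 2 + 2048 / δ) := fun w hw => by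
    have hbound : ∀ v ∈ Icc y w, ‖V v / (1 - v ^ 2)‖ ≤ 2 * √D * r * (Λ / r ^ 6) := fun v hv => by
      have hv' : v ∈ Icc y z := ⟨hv.1, hv.2.trans hw.2⟩
      have hpv : r ^ 6 / Λ ≤ 1 - v ^ 2 := by
        have h2 := potential_antitone (m := m) hΛ.le (hy0.le.trans hv'.1) hv'.2
        rw [hQz, hm] at h2
        rw [div_le_iff₀ hΛ]
        linarith
      have hp0 : 0 < r ^ 6 / Λ := by positivity
      have hV1 : |V v| ≤ 2 * √D * r := by
        apply abs_le_of_sq_le_sq _ (by positivity)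
        calc V v ^ 2 ≤ 4 * D * r ^ 2 := hVmid v hv'
          _ = (2 * √D * r) ^ 2 := by rw [mul_pow, mul_pow, Real.sq_sqrt hD]; ring
      rw [Real.norm_eq_abs, abs_div, abs_of_pos (hp0.trans_le hpv),
        div_le_iff₀ (hp0.trans_le hpv)]
      calc |V v| ≤ 2 * √D * r := hV1
        _ = 2 * √D * r * (Λ / r ^ 6) * (r ^ 6 / Λ) := by field_simp
        _ ≤ _ := by gcongr
    have hdiff := (convex_Icc y w).norm_image_sub_le_of_norm_hasDerivWithin_le
      (f := u) (f' := fun v => V v / (1 - v ^ 2))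
      (fun v hv => (h.hasDerivAt_u v ⟨hy0.le.trans hv.1,
        (hv.2.trans hw.2).trans_lt hz1⟩).hasDerivWithinAt) hbound
      (left_mem_Icc.2 hw.1) (right_mem_Icc.2 hw.1)
    have hlen : w - y ≤ 16 * r ^ 4 / Λ / y := by
      rw [le_div_iff₀ hy0, ← hzy]
      nlinarith [hw.1, hw.2]
    have hdiff2 : (u w - u y) ^ 2 ≤ 1024 * D / (r ^ 2 * δ) := by
      have h1 : |u w - u y| ≤ 2 * √D * r * (Λ / r ^ 6) * (16 * r ^ 4 / Λ / y) := by
        rw [Real.norm_eq_abs, Real.norm_eq_abs, abs_of_nonneg (sub_nonneg.2 hw.1)] at hdiff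
        exact hdiff.trans (by gcongr)
      have h2 : (u w - u y) ^ 2 ≤ (2 * √D * r * (Λ / r ^ 6) * (16 * r ^ 4 / Λ / y)) ^ 2 :=
        sq_le_sq' (abs_le.1 h1).1 (abs_le.1 h1).2
      refine h2.trans ?_
      have h3 : (2 * √D * r * (Λ / r ^ 6) * (16 * r ^ 4 / Λ / y)) ^ 2
          = 1024 * (√D) ^ 2 / (r ^ 2 * y ^ 2) := by
        field_simp
        ring
      rw [h3, Real.sq_sqrt hD]
      gcongr
      linarith
    have h4 : u w ^ 2 ≤ 2 * u y ^ 2 + 2 * (u w - u y) ^ 2 := by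
      nlinarith [sq_nonneg (u w - 2 * u y)]
    calc r ^ 2 * u w ^ 2 ≤ r ^ 2 * (2 * (D / (4 * r ^ 2)) + 2 * (1024 * D / (r ^ 2 * δ))) := by
          gcongr
          linarith
      _ = D * (1 / 2 + 2048 / δ) := by field_simp; ring
  have hx_ge : ∀ {w : ℝ}, 0 < w → Λ * (1 - x ^ 2) - m ^ 2 ≤ Λ * (1 - w ^ 2) - m ^ 2 → w ≤ x := by
    intro w hw hle
    have h1 : w ^ 2 ≤ x ^ 2 := by
      refine le_of_mul_le_mul_left ?_ hΛ
      linarith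
    exact abs_le_of_sq_le_sq h1 hx.1 |> (le_abs_self w).trans
  refine ⟨fun hQ => ?_, fun hQ => ?_⟩
  · have hyx := hx_ge hy0 (hQ.trans hQy.ge)
    rcases le_total x z with hxz | hzx
    · exact humid x ⟨hyx, hxz⟩
    · have := h.sq_antitoneOn_of_forbidden hΛ.le hz0.le hQz.le (left_mem_Icc.2 hz1.le)
        ⟨hzx, hx.2⟩ hzx
      exact (mul_le_mul_of_nonneg_left this (sq_nonneg r)).trans (humid z ⟨hyz, le_rfl⟩)
  · have hzx := hx_ge hz0 (hQ.trans hQz.ge)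
    have h1 := h.sq_deriv_antitoneOn_of_forbidden hΛ.le hz0.le hQz.le (left_mem_Icc.2 hz1.le)
        ⟨hzx, hx.2⟩ hzx
    have h2 := hVmid z ⟨hyz, le_rfl⟩
    have h3 := h.energy_nonneg hΛ.le hx
    simp only at h1
    linarith

end IsLegendreSol

lemma legendreD_neg_sq (n m : ℕ) (x : ℝ) : legendreD n m (-x) ^ 2 = legendreD n m x ^ 2 := by
  have h0 : ∀ y, legendreP n (-y) = (-1) ^ n * legendreP n y := fun y => by
    have h := iteratedDeriv_comp_neg n (fun y : ℝ => (y ^ 2 - 1) ^ n) y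
    simp only [neg_sq, smul_eq_mul] at h
    simp only [legendreP]
    rw [h]
    have : ((-1:ℝ) ^ n) * (-1) ^ n = 1 := by rw [← mul_pow]; simp
    linear_combination (-((2:ℝ)^n * (Nat.factorial n : ℝ))⁻¹ *
      iteratedDeriv n (fun y : ℝ => (y ^ 2 - 1) ^ n) (-y)) * this
  have h1 := iteratedDeriv_comp_neg m (legendreP n) x
  rw [funext h0, iteratedDeriv_const_mul_field, iteratedDeriv_legendreP, smul_eq_mul] at h1
  have h2 := congrArg (· ^ 2) h1
  simp only [mul_pow] at h2
  simpa [← pow_mul, mul_comm _ 2] using h2.symm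

lemma tY_sq {n : ℕ} {m : ℤ} (h : m.natAbs ≤ n) (x : ℝ) :
    tY n m x ^ 2 = normSq n m.natAbs *
      (√(1 - x ^ 2) ^ m.natAbs * legendreD n m.natAbs x) ^ 2 := by
  unfold tY
  rw [mul_pow, Real.sq_sqrt (by positivity)]
  have hs : ∀ k : ℕ, ((-1:ℝ) ^ k) ^ 2 = 1 := fun k => by rw [← pow_mul, mul_comm, pow_mul]; simp
  by_cases hm : 0 ≤ m
  · obtain ⟨k, rfl⟩ := Int.eq_ofNat_of_zero_le hm
    have e1 : ((n : ℤ) - k).toNat = n - k := by omega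
    have e2 : ((n : ℤ) + k).toNat = n + k := by omega
    simp only [assocPZ, hm, if_true, assocP, iteratedDeriv_legendreP, normSq, Int.toNat_natCast,
      Int.natAbs_natCast, mul_pow, hs, one_mul, e1, e2]
  · have e1 : ((n : ℤ) - m).toNat = n + m.natAbs := by omega
    have e2 : ((n : ℤ) + m).toNat = n - m.natAbs := by omega
    simp only [assocPZ, hm, if_false, assocP, iteratedDeriv_legendreP, normSq, mul_pow, hs,
      one_mul, e1, e2, div_pow]
    have : (Nat.factorial (n + m.natAbs) : ℝ) ≠ 0 := by positivity
    have : (Nat.factorial (n - m.natAbs) : ℝ) ≠ 0 := by positivity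
    field_simp

/-- The normalised associated Legendre function of order `m ≥ 0`, up to sign. -/
def normLegendre (n m : ℕ) (x : ℝ) : ℝ :=
  √(normSq n m) * √(1 - x ^ 2) ^ m * legendreD n m x

/-- The image of `normLegendre n m` under `(1 - x²) d/dx`. -/
def normLegendreD (n m : ℕ) (x : ℝ) : ℝ :=
  √(normSq n m) * √(1 - x ^ 2) ^ m *
    (-(m * x) * legendreD n m x + (1 - x ^ 2) * legendreD n (m + 1) x)

lemma normLegendre_sq (n m : ℕ) (x : ℝ) :
    normLegendre n m x ^ 2 = normSq n m * (√(1 - x ^ 2) ^ m * legendreD n m x) ^ 2 := by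
  rw [normLegendre, mul_assoc, mul_pow, Real.sq_sqrt (normSq_nonneg n m)]

lemma tY_sq_eq_normLegendre_abs {n : ℕ} {m : ℤ} (h : m.natAbs ≤ n) (x : ℝ) :
    tY n m x ^ 2 = normLegendre n m.natAbs |x| ^ 2 := by
  rw [tY_sq h, normLegendre_sq, mul_pow, mul_pow, sq_abs]
  rcases abs_choice x with hx | hx <;> rw [hx]
  rw [legendreD_neg_sq]

lemma isLegendreSol_normLegendre (n : ℕ) {m : ℕ} (hm : m ≠ 0) :
    IsLegendreSol (n * (n + 1)) m (normLegendre n m) (normLegendreD n m) := by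
  have hw : ∀ x ∈ Ico (0:ℝ) 1, HasDerivAt (fun x : ℝ => √(1 - x ^ 2) ^ m)
      (-(m * x) * √(1 - x ^ 2) ^ m / (1 - x ^ 2)) x := fun x hx => by
    have hp := one_sub_sq_pos hx
    have h1 := ((((hasDerivAt_id x).pow 2).const_sub 1).sqrt hp.ne').pow m
    refine h1.congr_deriv ?_
    obtain ⟨k, rfl⟩ := Nat.exists_eq_succ_of_ne_zero hm
    have hs : √(1 - x ^ 2) ≠ 0 := (Real.sqrt_pos.2 hp).ne'
    have hsq : √(1 - x ^ 2) ^ 2 = 1 - x ^ 2 := Real.sq_sqrt hp.le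
    simp only [Pi.pow_apply, id, Nat.succ_eq_add_one, Nat.add_sub_cancel, pow_succ √(1 - x ^ 2)]
    push_cast
    generalize √(1 - x ^ 2) = w at *
    rw [← hsq]
    field_simp
  have hf : ∀ x, HasDerivAt (legendreD n m) (legendreD n (m + 1) x) x := hasDerivAt_legendreD n m
  have hf' : ∀ x, HasDerivAt (legendreD n (m + 1)) (legendreD n (m + 2) x) x :=
    hasDerivAt_legendreD n (m + 1)
  have c1 := continuous_legendreD n m
  have c2 := continuous_legendreD n (m + 1)
  refine ⟨fun x hx => ?_, fun x hx => ?_, ?_, ?_, ?_, ?_⟩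
  · have hp := (one_sub_sq_pos hx).ne'
    refine (((hw x hx).const_mul (√(normSq n m))).mul (hf x)).congr_deriv ?_
    unfold normLegendreD
    field_simp
  · have hp := (one_sub_sq_pos hx).ne'
    refine (((hw x hx).const_mul (√(normSq n m))).mul
      (((((hasDerivAt_id x).const_mul (m:ℝ)).neg).mul (hf x)).add
      ((((hasDerivAt_id x).pow 2).const_sub 1).mul (hf' x)))).congr_deriv ?_
    unfold normLegendre
    have h := legendreD_ode n m x
    simp only [Pi.pow_apply, Pi.mul_apply, Pi.add_apply, Pi.neg_apply, id]
    push_cast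
    field_simp
    linear_combination (√(normSq n m) * √(1 - x ^ 2) ^ m * (1 - x ^ 2)) * h
  · unfold normLegendre; fun_prop
  · unfold normLegendreD; fun_prop
  · simp [normLegendre, hm]
  · simp [normLegendreD, hm]

lemma normLegendre_zero_order_le {n : ℕ} (hn : 1 ≤ n) {x : ℝ} (hx : x ∈ Icc (0:ℝ) 1) :
    normLegendre n 0 x ^ 2 ≤ (2 * n + 1) / (4 * Real.pi) := by
  have hΛ : (0:ℝ) < n * (n + 1) := by
    have : (0:ℝ) < n := by exact_mod_cast hn
    positivity
  have c1 := continuous_legendreD n 0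
  have c2 := continuous_legendreD n 1
  have hmono : AntitoneOn (fun x => -(n * (n + 1) * legendreD n 0 x ^ 2
      + (1 - x ^ 2) * legendreD n 1 x ^ 2)) (Icc 0 1) := by
    refine antitoneOn_of_hasDerivAt_nonpos (f' := fun x => -(2 * x * legendreD n 1 x ^ 2))
      (by fun_prop) (fun x hx => ?_) (fun x hx => ?_)
    · refine ((((hasDerivAt_legendreD n 0 x).pow 2).const_mul ((n:ℝ) * (n + 1))).add
        ((((hasDerivAt_id x).pow 2).const_sub 1).mul
          ((hasDerivAt_legendreD n 1 x).pow 2))).neg.congr_deriv ?_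
      have h := legendreD_ode n 0 x
      simp only [Pi.pow_apply, id]
      push_cast at h ⊢
      simp only [zero_add] at h ⊢
      linear_combination (-2 * legendreD n 1 x) * h
    · have := hx.1
      have : 0 ≤ 2 * x * legendreD n 1 x ^ 2 := by positivity
      linarith
  have h := hmono hx (right_mem_Icc.2 zero_le_one) hx.2
  simp only [legendreD_zero_one] at h
  have hp : 0 ≤ 1 - x ^ 2 := by nlinarith [hx.1, hx.2]
  have h1 : 0 ≤ (1 - x ^ 2) * legendreD n 1 x ^ 2 := by positivity
  have h2 : legendreD n 0 x ^ 2 ≤ 1 := by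
    refine le_of_mul_le_mul_left ?_ hΛ
    linarith
  rw [normLegendre_sq, pow_zero, one_mul]
  have : normSq n 0 = (2 * n + 1) / (4 * Real.pi) := by
    simp [normSq, div_self (show (Nat.factorial n : ℝ) ≠ 0 by positivity)]
  rw [this]
  exact mul_le_of_le_one_right (by positivity) h2

/-- Bounds for `normLegendre` on both sides of its turning point, uniform in the Bessel regime. -/
lemma exists_normLegendre_bounds {η : ℝ} (hη0 : 0 ≤ η) (hη : η < 1) :
    ∃ K T : ℝ, 0 < K ∧ ∀ n m : ℕ, ∀ r x : ℝ, m ≠ 0 → m ≤ n →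
      (m : ℝ) ^ 2 ≤ η * (n * (n + 1)) → T ≤ n * (n + 1) → 1 ≤ r → r ^ 3 = m → x ∈ Icc (0:ℝ) 1 →
      (16 * r ^ 4 ≤ n * (n + 1) * (1 - x ^ 2) - (m : ℝ) ^ 2 →
        √(n * (n + 1) * (1 - x ^ 2) - (m : ℝ) ^ 2) * normLegendre n m x ^ 2
          ≤ K * √(n * (n + 1))) ∧
      (n * (n + 1) * (1 - x ^ 2) - (m : ℝ) ^ 2 ≤ 16 * r ^ 4 →
        r ^ 2 * normLegendre n m x ^ 2 ≤ K * √(n * (n + 1))) ∧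
      (n * (n + 1) * (1 - x ^ 2) - (m : ℝ) ^ 2 ≤ 0 →
        -(n * (n + 1) * (1 - x ^ 2) - (m : ℝ) ^ 2) * normLegendre n m x ^ 2
          ≤ K * √(n * (n + 1)) * r ^ 2) := by
  obtain ⟨c, rfl⟩ : ∃ c, η = 1 - c := ⟨1 - η, by ring⟩
  have hc0 : 0 < c := by linarith
  have hc1 : c ≤ 1 := by linarith
  refine ⟨18 / c ^ 2 * (4 + 4096 / c), (32 / c) ^ 3, by positivity, ?_⟩
  intro n m r x hm0 hmn hm hT hr hrm hx
  have hn1 : 1 ≤ n := le_trans (Nat.one_le_iff_ne_zero.2 hm0) hmn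
  have hsol := isLegendreSol_normLegendre n hm0
  have hE := equator_energy_le hmn hn1 hη0 hη hm
  have hE0 : normLegendreD n m 0 ^ 2 + n * (n + 1) * normLegendre n m 0 ^ 2
      ≤ 2 / c * (n * (n + 1)) := by
    simp only [normLegendreD, normLegendre]
    simp only [ne_eq, OfNat.ofNat_ne_zero, not_false_eq_true, zero_pow, sub_zero, Real.sqrt_one,
      one_pow, mul_one, mul_zero, neg_zero, zero_mul, zero_add, one_mul, mul_pow,
      Real.sq_sqrt (normSq_nonneg n m)]
    rw [sub_sub_cancel] at hE
    exact hE
  have hΛ : (0:ℝ) < n * (n + 1) := by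
    have : (0:ℝ) < n := by exact_mod_cast hn1
    positivity
  generalize (n:ℝ) * (n + 1) = Λ at *
  have hm6 : (m:ℝ) ^ 2 = r ^ 6 := by rw [← hrm]; ring
  have hs : 0 < √Λ := Real.sqrt_pos.2 hΛ
  have hss : √Λ * √Λ = Λ := Real.mul_self_sqrt hΛ.le
  set D := 18 / c ^ 2 * √Λ with hDdef
  have hD : 0 < D := by positivity
  have hc2 : c * √Λ ≤ √(Λ - (m:ℝ) ^ 2) := by
    apply Real.le_sqrt_of_sq_le
    rw [mul_pow, Real.sq_sqrt hΛ.le]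
    nlinarith
  have hA : ∀ x ∈ Icc (0:ℝ) 1, 16 * r ^ 4 ≤ Λ * (1 - x ^ 2) - (m:ℝ) ^ 2 →
      normLegendreD n m x ^ 2 + (Λ * (1 - x ^ 2) - (m:ℝ) ^ 2) * normLegendre n m x ^ 2
        ≤ D * √(Λ * (1 - x ^ 2) - (m:ℝ) ^ 2) := by
    intro x hx hQ
    have h1 := hsol.energy_allowed_le hΛ hr hm6 hx hQ
    have hQ0 : 0 ≤ Λ * (1 - x ^ 2) - (m:ℝ) ^ 2 := le_trans (by positivity) hQ
    generalize Λ * (1 - x ^ 2) - (m:ℝ) ^ 2 = Q at *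
    have h2 := mul_le_mul_of_nonneg_left hE0 (show 0 ≤ 9 * √Q by positivity)
    have h3 := mul_le_mul_of_nonneg_left hc2
      (show 0 ≤ normLegendreD n m x ^ 2 + Q * normLegendre n m x ^ 2 by positivity)
    refine le_of_mul_le_mul_right (a := c * √Λ) ?_ (by positivity)
    refine (h3.trans (h1.trans h2)).trans (le_of_eq ?_)
    have e : 18 / c ^ 2 * √Λ * √Q * (c * √Λ) = 18 / c * √Q * (√Λ * √Λ) := by field_simp
    rw [hDdef, e, hss]
    ring
  have hr0 : 0 < r := by linarith
  have h16 : 16 * r ^ 4 ≤ c / 2 * Λ := by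
    have hrΛ : r ^ 6 ≤ Λ := by rw [← hm6]; nlinarith
    rcases le_total (32 / c) (r ^ 2) with h | h
    · rw [div_le_iff₀ hc0] at h
      have := mul_le_mul_of_nonneg_left h (show 0 ≤ r ^ 4 by positivity)
      nlinarith
    · have h4 : (r ^ 2) ^ 2 ≤ (32 / c) ^ 2 := pow_le_pow_left₀ (by positivity) h 2
      have : c / 2 * (32 / c) ^ 3 = 16 * (32 / c) ^ 2 := by field_simp; norm_num
      nlinarith
  have hδ : c / 2 * Λ + 16 * r ^ 4 + (m:ℝ) ^ 2 ≤ Λ := by linarith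
  obtain ⟨hB, hC⟩ := hsol.turning_point_bounds hΛ hr hm6 hD.le (half_pos hc0) hδ hA hx
  have hKD : 18 / c ^ 2 * (4 + 4096 / c) * √Λ = D * (4 + 4096 / c) := by rw [hDdef]; ring
  have hcc : 0 < 4096 / c := by positivity
  rw [hKD]
  refine ⟨fun hQ => ?_, fun hQ => ?_, fun hQ => ?_⟩
  · have h1 := hA x hx hQ
    have hQ0 : 0 < Λ * (1 - x ^ 2) - (m:ℝ) ^ 2 := lt_of_lt_of_le (by positivity) hQ
    generalize Λ * (1 - x ^ 2) - (m:ℝ) ^ 2 = Q at *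
    have hq := Real.sqrt_pos.2 hQ0
    have hqq := Real.mul_self_sqrt hQ0.le
    refine le_of_mul_le_mul_right (a := √Q) ?_ hq
    have : √Q * normLegendre n m x ^ 2 * √Q = Q * normLegendre n m x ^ 2 := by
      linear_combination normLegendre n m x ^ 2 * hqq
    have h2 : 0 ≤ D * √Q * (3 + 4096 / c) := by positivity
    nlinarith [sq_nonneg (normLegendreD n m x)]
  · refine (hB hQ).trans (mul_le_mul_of_nonneg_left ?_ hD.le)
    have : 2048 / (c / 2) = 4096 / c := by field_simp; norm_num
    linarith
  · have : 0 ≤ D * (4096 / c) * r ^ 2 := by positivity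
    linarith [hC hQ]

lemma normLegendre_sq_le_of_allowed {η : ℝ} (hη0 : 0 ≤ η) (hη : η < 1) {n m : ℕ} (hm0 : m ≠ 0)
    (hmn : m ≤ n) (hm : (m : ℝ) ^ 2 ≤ η * (n * (n + 1))) {x : ℝ} (hx : x ∈ Icc (0:ℝ) 1)
    (hx2 : x ^ 2 ≤ (1 - η) / 2) : normLegendre n m x ^ 2 ≤ 4 / (1 - η) ^ 2 := by
  have hn1 : 1 ≤ n := le_trans (Nat.one_le_iff_ne_zero.2 hm0) hmn
  have hE := equator_energy_le hmn hn1 hη0 hη hm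
  have hΛ : (0:ℝ) < n * (n + 1) := by
    have : (0:ℝ) < n := by exact_mod_cast hn1
    positivity
  have h := (isLegendreSol_normLegendre n hm0).energy_antitoneOn hΛ.le
    (left_mem_Icc.2 zero_le_one) hx hx.1
  have hE0 : normLegendreD n m 0 ^ 2 + (n * (n + 1) * (1 - 0 ^ 2) - (m : ℝ) ^ 2)
      * normLegendre n m 0 ^ 2 ≤ 2 / (1 - η) * (n * (n + 1)) := by
    have : 0 ≤ (m : ℝ) ^ 2 * normLegendre n m 0 ^ 2 := by positivity
    refine le_trans ?_ hE
    simp only [normLegendreD, normLegendre] at this ⊢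
    simp only [ne_eq, OfNat.ofNat_ne_zero, not_false_eq_true, zero_pow, sub_zero, Real.sqrt_one,
      one_pow, mul_one, mul_zero, neg_zero, zero_mul, zero_add, one_mul, mul_pow,
      Real.sq_sqrt (normSq_nonneg n m)] at this ⊢
    linarith
  have hc : 0 < 1 - η := by linarith
  generalize (n:ℝ) * (n + 1) = Λ at *
  have hQ : (1 - η) / 2 * Λ ≤ Λ * (1 - x ^ 2) - (m : ℝ) ^ 2 := by nlinarith
  have h1 := mul_le_mul_of_nonneg_right hQ (sq_nonneg (normLegendre n m x))
  refine le_of_mul_le_mul_left (a := (1 - η) / 2 * Λ) ?_ (by positivity)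
  have : (1 - η) / 2 * Λ * (4 / (1 - η) ^ 2) = 2 / (1 - η) * Λ := by field_simp; ring
  rw [this]
  have := sq_nonneg (normLegendreD n m x)
  linarith [hE0, h, h1]

lemma exists_normLegendre_sq_le_of_le (M : ℕ) :
    ∃ B : ℝ, 0 ≤ B ∧ ∀ n m : ℕ, n ≤ M → m ≤ n → ∀ x ∈ Icc (0:ℝ) 1,
      normLegendre n m x ^ 2 ≤ B := by
  have hb : ∀ n m : ℕ, ∃ B : ℝ, ∀ x ∈ Icc (0:ℝ) 1, normLegendre n m x ^ 2 ≤ B := fun n m => by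
    have c1 := continuous_legendreD n m
    have hc : Continuous fun x => normLegendre n m x ^ 2 := by unfold normLegendre; fun_prop
    obtain ⟨B, hB⟩ := (isCompact_Icc (a := (0:ℝ)) (b := 1)).bddAbove_image hc.continuousOn
    exact ⟨B, fun x hx => hB ⟨x, hx, rfl⟩⟩
  choose B hB using hb
  refine ⟨∑ n ∈ Finset.range (M + 1), ∑ m ∈ Finset.range (M + 1), |B n m|, by positivity, ?_⟩
  intro n m hn hm x hx
  refine (hB n m x hx).trans ((le_abs_self _).trans ?_)
  refine (Finset.single_le_sum (f := fun m => |B n m|) (fun _ _ => abs_nonneg _)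
    (Finset.mem_range.2 (by omega : m < M + 1))).trans ?_
  exact Finset.single_le_sum (f := fun n => ∑ m ∈ Finset.range (M + 1), |B n m|)
    (fun _ _ => by positivity) (Finset.mem_range.2 (by omega : n < M + 1))

lemma tsum_le_two_mul_tsum {α : Type*} {a : α → ℕ} {b : α → Bool}
    (hab : Function.Injective fun p => (a p, b p)) {f : α → ℝ≥0∞} {H : ℕ → ℝ≥0∞}
    (hf : ∀ p, f p ≤ H (a p)) : ∑' p, f p ≤ 2 * ∑' n, H n := by
  calc ∑' p, f p ≤ ∑' p, (fun q : ℕ × Bool => H q.1) (a p, b p) := ENNReal.tsum_le_tsum hf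
    _ ≤ ∑' q : ℕ × Bool, H q.1 :=
        ENNReal.tsum_comp_le_tsum_of_injective hab (fun q : ℕ × Bool => H q.1)
    _ = ∑' n, ∑' _ : Bool, H n := ENNReal.tsum_prod' (f := fun q : ℕ × Bool => H q.1)
    _ = 2 * ∑' n, H n := by
        simp only [tsum_fintype, Fintype.sum_bool, ← two_mul, ENNReal.tsum_mul_left]

lemma sum_inv_sqrt_le (k : ℕ) : ∑ d ∈ Finset.range k, (√((d : ℝ) + 1))⁻¹ ≤ 2 * √k := by
  induction k with
  | zero => simp
  | succ k ih =>
    rw [Finset.sum_range_succ]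
    refine (add_le_add_left ih _).trans ?_
    push_cast
    have h1 : 0 < √((k:ℝ) + 1) := Real.sqrt_pos.2 (by positivity)
    have h2 := Real.mul_self_sqrt (show (0:ℝ) ≤ k + 1 by positivity)
    have h3 := Real.mul_self_sqrt (show (0:ℝ) ≤ k by positivity)
    have h4 : (√((k:ℝ) + 1))⁻¹ * √((k:ℝ) + 1) = 1 := inv_mul_cancel₀ h1.ne'
    refine le_of_mul_le_mul_right (a := √((k:ℝ) + 1)) ?_ h1
    nlinarith [sq_nonneg (√((k:ℝ) + 1) - √k)]

lemma tsum_inv_sqrt_le (k : ℕ) :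
    ∑' m : ℕ, (if m < k then ENNReal.ofReal (√((k:ℝ) * (k - m)))⁻¹ else 0) ≤ 2 := by
  rw [tsum_eq_sum (s := Finset.range k) fun m hm => if_neg (by simpa using hm)]
  rw [Finset.sum_congr rfl fun m hm => if_pos (Finset.mem_range.1 hm),
    ← ENNReal.ofReal_sum_of_nonneg fun _ _ => by positivity]
  rw [show (2:ℝ≥0∞) = ENNReal.ofReal 2 by simp]
  apply ENNReal.ofReal_le_ofReal
  rw [← Finset.sum_range_reflect]
  rcases Nat.eq_zero_or_pos k with rfl | hk
  · simp
  have hk' : 0 < √(k:ℝ) := Real.sqrt_pos.2 (by exact_mod_cast hk)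
  calc _ = ∑ d ∈ Finset.range k, (√(k:ℝ))⁻¹ * (√((d:ℝ) + 1))⁻¹ := by
        refine Finset.sum_congr rfl fun d hd => ?_
        have hd := Finset.mem_range.1 hd
        rw [← mul_inv, ← Real.sqrt_mul (by positivity)]
        congr 3
        have : k - 1 - d = k - (d + 1) := by omega
        rw [this, Nat.cast_sub hd]
        push_cast
        ring
    _ ≤ (√(k:ℝ))⁻¹ * (2 * √k) := by
        rw [← Finset.mul_sum]
        exact mul_le_mul_of_nonneg_left (sum_inv_sqrt_le k) (by positivity)
    _ = 2 := by field_simp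

/-- Majorant, as a function of the distance to the turning point, of the Bessel-regime cluster. -/
def clusterTail (n₀ n : ℕ) : ℝ := (if n ≤ n₀ then 1 else 0) + ((n : ℝ) ^ (4 / 3 : ℝ))⁻¹

lemma clusterTail_nonneg (n₀ n : ℕ) : 0 ≤ clusterTail n₀ n := by
  unfold clusterTail
  positivity

lemma summable_clusterTail (n₀ : ℕ) : Summable (clusterTail n₀) := by
  refine Summable.add ?_ (Real.summable_nat_rpow_inv.2 (by norm_num))
  exact summable_of_ne_finset_zero (s := Finset.range (n₀ + 1)) fun n hn =>
    if_neg (by simpa using hn)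

lemma exists_tsum_cluster_majorant_le (n₀ : ℕ) : ∃ A : ℝ, 0 ≤ A ∧ ∀ k : ℕ,
    ∑' m : ℕ, (ENNReal.ofReal (clusterTail n₀ ((m - k) + (k - m)))
      + if m < k then ENNReal.ofReal (√((k:ℝ) * (k - m)))⁻¹ else 0) ≤ ENNReal.ofReal A := by
  have h0 : 0 ≤ ∑' n, clusterTail n₀ n := tsum_nonneg (clusterTail_nonneg n₀)
  refine ⟨2 * ∑' n, clusterTail n₀ n + 2, by positivity, fun k => ?_⟩
  rw [ENNReal.tsum_add, ENNReal.ofReal_add (by positivity) (by positivity),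
    ENNReal.ofReal_mul (by positivity), ENNReal.ofReal_tsum_of_nonneg (clusterTail_nonneg n₀)
      (summable_clusterTail n₀), show ENNReal.ofReal 2 = 2 by simp]
  refine add_le_add (tsum_le_two_mul_tsum (a := fun m => (m - k) + (k - m))
    (b := fun m => decide (k ≤ m)) ?_ fun m => le_rfl) (tsum_inv_sqrt_le k)
  intro m m' h
  simp only [Prod.mk.injEq, decide_eq_decide] at h
  omega

lemma sqrt_le_of_cluster {c Λ m : ℝ} {i : ℕ} (hc0 : 0 < c) (hc1 : c ≤ 1) (hi : 1 ≤ i)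
    (hm : m ^ 2 ≤ (1 - c) * Λ) (h : Λ - m ^ 2 ≤ ((i:ℝ) + 1) ^ 2) : √Λ ≤ 2 / c * i := by
  have hi' : (1:ℝ) ≤ i := by exact_mod_cast hi
  apply Real.sqrt_le_iff.2 ⟨by positivity, ?_⟩
  have h1 : c * Λ ≤ 4 * i ^ 2 := by nlinarith
  have h2 : (2 / c * i) ^ 2 = (4 * i ^ 2) / c / c := by field_simp; norm_num
  rw [h2, le_div_iff₀ hc0, le_div_iff₀ hc0]
  have : Λ * c * c ≤ Λ * c := by
    rcases le_total 0 Λ with h0 | h0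
    · exact mul_le_of_le_one_right (by positivity) hc1
    · nlinarith [sq_nonneg m, sq_nonneg (i:ℝ)]
  linarith

lemma le_of_oscillating_side {c W U Q r k d : ℝ} (hc0 : 0 < c) (hc1 : c ≤ 1) (hW : 0 ≤ W)
    (hU : 0 ≤ U) (hr : 1 ≤ r) (hrk : r ^ 3 ≤ k) (hd : 1 ≤ d) (hQ : c / 2 * (k * d) ≤ Q)
    (hA : 16 * r ^ 4 ≤ Q → √Q * U ≤ W) (hB : Q ≤ 16 * r ^ 4 → r ^ 2 * U ≤ W) :
    U ≤ W * ((32 / c) ^ 2 * ((d ^ (4 / 3 : ℝ))⁻¹ + (√(k * d))⁻¹)) := by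
  have hr0 : 0 < r := by linarith
  have hk : 0 < k := lt_of_lt_of_le (by positivity) hrk
  have hkd : 0 < k * d := by positivity
  have h32 : 1 ≤ 32 / c := by rw [le_div_iff₀ hc0]; linarith
  have hd43 : 0 < d ^ (4 / 3 : ℝ) := by positivity
  rcases le_total (16 * r ^ 4) Q with h | h
  · have hsq : c / 2 * √(k * d) ≤ √Q := by
      apply Real.le_sqrt_of_sq_le
      rw [mul_pow, Real.sq_sqrt hkd.le]
      refine le_trans (mul_le_mul_of_nonneg_right ?_ hkd.le) hQ
      nlinarith
    have hsk := Real.sqrt_pos.2 hkd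
    have h1 := (mul_le_mul_of_nonneg_right hsq hU).trans (hA h)
    have h2 : U ≤ W * (2 / c * (√(k * d))⁻¹) := by
      refine le_of_mul_le_mul_left (a := c / 2 * √(k * d)) (h1.trans (le_of_eq ?_))
        (by positivity)
      field_simp
    refine h2.trans (mul_le_mul_of_nonneg_left (mul_le_mul ?_ ?_ ?_ ?_) hW)
    · have : 2 / c ≤ 32 / c := by gcongr; norm_num
      exact this.trans (le_self_pow₀ h32 two_ne_zero)
    · exact le_add_of_nonneg_left (by positivity)
    · positivity
    · positivity
  · have hdr : d ≤ 32 / c * r := by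
      rw [div_mul_eq_mul_div, le_div_iff₀ hc0]
      refine le_of_mul_le_mul_right (a := r ^ 3) ?_ (by positivity)
      have h1 : r ^ 3 * d ≤ k * d := by gcongr
      have h2 := mul_le_mul_of_nonneg_left h1 hc0.le
      linarith
    have h1 : d ^ 2 ≤ (32 / c) ^ 2 * r ^ 2 := by
      rw [← mul_pow]
      exact pow_le_pow_left₀ (by linarith) hdr 2
    have hpow : d ^ (4 / 3 : ℝ) ≤ d ^ 2 := by
      rw [← Real.rpow_natCast]
      exact Real.rpow_le_rpow_of_exponent_le hd (by norm_num)
    have h2 : U ≤ W * (r ^ 2)⁻¹ := by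
      rw [← div_eq_mul_inv, le_div_iff₀ (by positivity)]
      linarith [hB h]
    refine h2.trans (mul_le_mul_of_nonneg_left ?_ hW)
    have h3 : (r ^ 2)⁻¹ ≤ (32 / c) ^ 2 * (d ^ (4 / 3 : ℝ))⁻¹ := by
      rw [← div_eq_mul_inv, inv_le_comm₀ (by positivity) (by positivity), inv_div,
        div_le_iff₀ (by positivity)]
      linarith
    refine h3.trans (mul_le_mul_of_nonneg_left ?_ (by positivity))
    exact le_add_of_nonneg_right (by positivity)

lemma le_of_decaying_side {c W U Q r d : ℝ} (hc0 : 0 < c) (hc1 : c ≤ 1) (hW : 0 ≤ W)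
    (hU : 0 ≤ U) (hr : 1 ≤ r) (hd : 0 < d) (hdr : d ≤ r ^ 3) (hQ : c / 4 * (r ^ 3 * d) ≤ -Q)
    (hC : Q ≤ 0 → -Q * U ≤ W * r ^ 2) :
    U ≤ W * ((32 / c) ^ 2 * (d ^ (4 / 3 : ℝ))⁻¹) := by
  have hr0 : 0 < r := by linarith
  have h32 : 1 ≤ 32 / c := by rw [le_div_iff₀ hc0]; linarith
  have hpow0 : 0 < d ^ (4 / 3 : ℝ) := by positivity
  have hpow : d ^ (4 / 3 : ℝ) ≤ r * d := by
    rw [show (4 / 3 : ℝ) = 1 / 3 + 1 by norm_num, Real.rpow_add hd, Real.rpow_one]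
    gcongr
    refine (Real.rpow_le_rpow hd.le hdr (by norm_num)).trans (le_of_eq ?_)
    rw [← Real.rpow_natCast, ← Real.rpow_mul hr0.le]
    norm_num
  have hQ0 : 0 ≤ c / 4 * (r ^ 3 * d) := by positivity
  have h1 := (mul_le_mul_of_nonneg_right hQ hU).trans (hC (by linarith))
  have h2 : U ≤ W * (4 / c * (r * d)⁻¹) := by
    refine le_of_mul_le_mul_left (a := c / 4 * (r ^ 3 * d)) (h1.trans (le_of_eq ?_))
      (by positivity)
    field_simp
  refine h2.trans (mul_le_mul_of_nonneg_left (mul_le_mul ?_ ?_ ?_ ?_) hW)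
  · have : 4 / c ≤ 32 / c := by gcongr; norm_num
    exact this.trans (le_self_pow₀ h32 two_ne_zero)
  · exact inv_anti₀ hpow0 hpow
  · positivity
  · positivity

set_option maxHeartbeats 1000000 in
lemma exists_cluster_majorant {η : ℝ} (hη0 : 0 ≤ η) (hη : η < 1) :
    ∃ C T : ℝ, ∃ n₀ : ℕ, 0 ≤ C ∧ ∀ i : ℕ, 1 ≤ i → T ≤ (i:ℝ) ^ 2 → ∀ x ∈ Icc (0:ℝ) 1,
      (1 - η) / 2 ≤ x ^ 2 → ∃ k : ℕ, ∀ n m : ℕ, m ≠ 0 → m ≤ n →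
        (m : ℝ) ^ 2 ≤ η * (n * (n + 1)) → (i:ℝ) ^ 2 ≤ n * (n + 1) - (m:ℝ) ^ 2 →
        n * (n + 1) - (m:ℝ) ^ 2 ≤ ((i:ℝ) + 1) ^ 2 →
        normLegendre n m x ^ 2 ≤ C * i * (clusterTail n₀ ((m - k) + (k - m))
          + if m < k then (√((k:ℝ) * (k - m)))⁻¹ else 0) := by
  obtain ⟨K, T, hK, hb⟩ := exists_normLegendre_bounds hη0 hη
  obtain ⟨c, rfl⟩ : ∃ c, η = 1 - c := ⟨1 - η, by ring⟩
  have hc0 : 0 < c := by linarith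
  have hc1 : c ≤ 1 := by linarith
  have h32 : 1 ≤ 32 / c := by rw [le_div_iff₀ hc0]; linarith
  obtain ⟨b, hb2⟩ := exists_nat_ge (2 / c)
  refine ⟨K * (2 / c) * (32 / c) ^ 2, T, 2 * (1 + b), by positivity, ?_⟩
  intro i hi hT x hx hx2
  rw [sub_sub_cancel] at hx2
  have hx0 : c / 2 ≤ x := by nlinarith [hx.1]
  have hxpos : 0 < x := by linarith
  obtain ⟨s, hs0, hs1, hs2⟩ : ∃ s : ℝ, 0 ≤ s ∧ s ≤ 1 ∧ s ^ 2 = 1 - x ^ 2 := by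
    have : 0 ≤ 1 - x ^ 2 := by nlinarith [hx.1, hx.2]
    refine ⟨√(1 - x ^ 2), Real.sqrt_nonneg _, ?_, Real.sq_sqrt this⟩
    exact Real.sqrt_le_one.2 (by nlinarith)
  have hsx : s ≤ b * x := by
    have h1 : 2 / c * (c / 2) = 1 := by field_simp
    have : 2 / c * (c / 2) ≤ b * x := mul_le_mul hb2 hx0 (by positivity) (by positivity)
    linarith
  set k := ⌊(i:ℝ) * s / x⌋₊ with hk
  have hk1 : (k:ℝ) * x ≤ i * s := by
    rw [← le_div_iff₀ hxpos]
    exact Nat.floor_le (by positivity)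
  have hk2 : (i:ℝ) * s ≤ (k + 1) * x := by
    rw [← div_le_iff₀ hxpos]
    exact (Nat.lt_floor_add_one _).le
  refine ⟨k, fun n m hm0 hmn hm hl1 hl2 => ?_⟩
  have hΛT : T ≤ n * (n + 1) := by nlinarith [sq_nonneg (m:ℝ)]
  have hm1 : (1:ℝ) ≤ m := by exact_mod_cast Nat.one_le_iff_ne_zero.2 hm0
  obtain ⟨r, hr1, hrm, hrr⟩ : ∃ r : ℝ, 1 ≤ r ∧ r ^ 3 = m ∧ r = (m:ℝ) ^ (1 / 3 : ℝ) := by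
    refine ⟨(m:ℝ) ^ (1 / 3 : ℝ), Real.one_le_rpow hm1 (by norm_num), ?_, rfl⟩
    rw [← Real.rpow_natCast, ← Real.rpow_mul (by positivity)]
    norm_num
  obtain ⟨hA, hB, hC⟩ := hb n m r x hm0 hmn hm hΛT hr1 hrm hx
  have hΛi := sqrt_le_of_cluster hc0 hc1 hi hm hl2
  have hQ1 : x ^ 2 * ((k:ℝ) ^ 2 - m ^ 2) ≤ n * (n + 1) * (1 - x ^ 2) - (m:ℝ) ^ 2 := by
    have h1 : ((k:ℝ) * x) ^ 2 ≤ (i * s) ^ 2 := pow_le_pow_left₀ (by positivity) hk1 2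
    have h2 := mul_le_mul_of_nonneg_right hl1 (sq_nonneg s)
    rw [mul_pow, mul_pow] at h1
    rw [hs2] at h1 h2
    linarith
  have hQ2 : n * (n + 1) * (1 - x ^ 2) - (m:ℝ) ^ 2 ≤ x ^ 2 * ((k + 1 + b) ^ 2 - m ^ 2) := by
    have h1 : ((i + 1) * s) ^ 2 ≤ ((k + 1 + b) * x) ^ 2 :=
      pow_le_pow_left₀ (by positivity) (by linarith) 2
    have h2 := mul_le_mul_of_nonneg_right hl2 (sq_nonneg s)
    rw [mul_pow, mul_pow] at h1
    rw [hs2] at h1 h2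
    linarith
  have hU := sq_nonneg (normLegendre n m x)
  generalize normLegendre n m x ^ 2 = U at *
  generalize n * (n + 1) * (1 - x ^ 2) - (m:ℝ) ^ 2 = Q at *
  generalize (n:ℝ) * (n + 1) = Λ at *
  set W := K * √Λ with hW
  have hW0 : 0 ≤ W := by positivity
  have hr0 : 0 < r := by linarith
  have hUW : U ≤ W := by
    rcases le_total (16 * r ^ 4) Q with h | h
    · refine le_trans (le_mul_of_one_le_left hU ?_) (hA h)
      have : 1 ≤ r ^ 4 := one_le_pow₀ hr1
      exact Real.one_le_sqrt.2 (by linarith)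
    · exact (le_mul_of_one_le_left hU (one_le_pow₀ hr1)).trans (hB h)
  set g := clusterTail (2 * (1 + b)) ((m - k) + (k - m))
    + if m < k then (√((k:ℝ) * (k - m)))⁻¹ else 0 with hg
  have hg0 : 0 ≤ g := by
    have := clusterTail_nonneg (2 * (1 + b)) ((m - k) + (k - m))
    split_ifs at hg <;> positivity
  suffices h : U ≤ W * ((32 / c) ^ 2 * g) by
    refine h.trans ?_
    have hWi : W ≤ K * (2 / c * i) := mul_le_mul_of_nonneg_left hΛi hK.le
    refine (mul_le_mul_of_nonneg_right hWi (by positivity)).trans (le_of_eq (by ring))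
  have h1024 : 1 ≤ (32 / c) ^ 2 := one_le_pow₀ h32
  by_cases hd : (m - k) + (k - m) ≤ 2 * (1 + b)
  · refine hUW.trans (le_mul_of_one_le_right hW0 ?_)
    have : 1 ≤ g := by
      rw [hg, clusterTail, if_pos hd]
      have h1 : 0 ≤ ((((m - k) + (k - m) : ℕ) : ℝ) ^ (4 / 3 : ℝ))⁻¹ := by positivity
      have h2 : 0 ≤ (if m < k then (√((k:ℝ) * (k - m)))⁻¹ else 0) := by split_ifs <;> positivity
      linarith
    nlinarith
  rw [hg, clusterTail, if_neg hd, zero_add]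
  rcases lt_or_ge m k with hmk | hmk
  · have hmk' : (m:ℝ) ≤ k := by exact_mod_cast hmk.le
    have hd1 : (1:ℝ) ≤ (k:ℝ) - m := by
      have : (m:ℝ) + 1 ≤ k := by exact_mod_cast hmk
      linarith
    rw [if_pos hmk, show (m - k) + (k - m) = k - m by omega, Nat.cast_sub hmk.le]
    refine le_of_oscillating_side hc0 hc1 hW0 hU hr1 (hrm.le.trans hmk') hd1 ?_ hA hB
    have h1 : (k:ℝ) * (k - m) ≤ k ^ 2 - m ^ 2 := by nlinarith
    have h2 := mul_le_mul hx2 h1 (by positivity) (by positivity)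
    linarith
  · rw [if_neg (by omega), add_zero, show (m - k) + (k - m) = m - k by omega, Nat.cast_sub hmk]
    have hd2 : 2 * (1 + (b:ℝ)) ≤ (m:ℝ) - k := by
      rw [← Nat.cast_sub hmk]
      exact_mod_cast (by omega : 2 * (1 + b) ≤ m - k)
    have hk0 : (0:ℝ) ≤ k := k.cast_nonneg
    have hb0 : (0:ℝ) ≤ b := b.cast_nonneg
    refine le_of_decaying_side hc0 hc1 hW0 hU hr1 (by linarith) (by linarith) ?_ hC
    rw [hrm]
    have h1 : (m:ℝ) * (m - k) / 2 ≤ m ^ 2 - (k + 1 + b) ^ 2 := by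
      have : (k + 1 + (b:ℝ)) ^ 2 ≤ (m - (m - k) / 2) ^ 2 :=
        pow_le_pow_left₀ (by positivity) (by linarith) 2
      nlinarith
    have h2 := mul_le_mul hx2 h1 (div_nonneg (mul_nonneg (by linarith) (by linarith))
      zero_le_two) (by positivity)
    linarith

lemma le_of_cluster {c : ℝ} {i n m : ℕ} (hc0 : 0 < c) (hc1 : c ≤ 1) (hi : 1 ≤ i)
    (hm : (m:ℝ) ^ 2 ≤ (1 - c) * (n * (n + 1)))
    (h : n * (n + 1) - (m:ℝ) ^ 2 ≤ ((i:ℝ) + 1) ^ 2) : (n:ℝ) ≤ 2 / c * i := by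
  refine le_trans (Real.le_sqrt_of_sq_le ?_) (sqrt_le_of_cluster hc0 hc1 hi hm h)
  have : (0:ℝ) ≤ n := n.cast_nonneg
  nlinarith

lemma tsum_ite_le_const {L : ℕ} {B c : ℝ} {i : ℕ} (hc0 : 0 < c) (hc1 : c ≤ 1) (hi : 1 ≤ i)
    (hB : 0 ≤ B) (hL : (L:ℝ) ≤ 2 / c * i) :
    ∑' m : ℕ, (if m ≤ L then ENNReal.ofReal B else 0) ≤ ENNReal.ofReal (3 / c * B * i) := by
  have hi' : (1:ℝ) ≤ i := by exact_mod_cast hi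
  rw [tsum_eq_sum (s := Finset.range (L + 1)) fun m hm =>
      if_neg (by simpa [Nat.lt_succ_iff] using hm),
    Finset.sum_congr rfl fun m hm => if_pos (Nat.lt_succ_iff.1 (Finset.mem_range.1 hm)),
    Finset.sum_const, Finset.card_range, nsmul_eq_mul, ← ENNReal.ofReal_natCast,
    ← ENNReal.ofReal_mul (by positivity)]
  apply ENNReal.ofReal_le_ofReal
  push_cast
  have h1 : 1 ≤ 1 / c := by rw [le_div_iff₀ hc0]; linarith
  have h2 : (L:ℝ) + 1 ≤ 3 / c * i := by
    have : 3 / c * i = 2 / c * i + 1 / c * i := by ring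
    nlinarith
  calc ((L:ℝ) + 1) * B ≤ 3 / c * i * B := by gcongr
    _ = _ := by ring

lemma exists_majorant_nonzero_order {η : ℝ} (hη0 : 0 ≤ η) (hη : η < 1) :
    ∃ C : ℝ, 0 ≤ C ∧ ∀ i : ℕ, 1 ≤ i → ∀ x ∈ Icc (0:ℝ) 1, ∃ G : ℕ → ℝ≥0∞,
      ∑' m, G m ≤ ENNReal.ofReal (C * i) ∧ ∀ n m : ℕ, m ≠ 0 → m ≤ n →
        (m : ℝ) ^ 2 ≤ η * (n * (n + 1)) → (i:ℝ) ^ 2 ≤ n * (n + 1) - (m:ℝ) ^ 2 →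
        n * (n + 1) - (m:ℝ) ^ 2 ≤ ((i:ℝ) + 1) ^ 2 →
        ENNReal.ofReal (normLegendre n m x ^ 2) ≤ G m := by
  obtain ⟨C₁, T, n₀, hC₁, hT⟩ := exists_cluster_majorant hη0 hη
  obtain ⟨A, hA0, hA⟩ := exists_tsum_cluster_majorant_le n₀
  obtain ⟨c, rfl⟩ : ∃ c, η = 1 - c := ⟨1 - η, by ring⟩
  rw [sub_sub_cancel] at hT
  have hc0 : 0 < c := by linarith
  have hc1 : c ≤ 1 := by linarith
  obtain ⟨B₁, hB₁0, hB₁⟩ := exists_normLegendre_sq_le_of_le ⌊2 / c * (|T| + 1)⌋₊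
  set B := B₁ + 4 / c ^ 2 with hB
  have hB0 : 0 ≤ B := by positivity
  refine ⟨3 / c * B + C₁ * A, by positivity, fun i hi x hx => ?_⟩
  have hi' : (1:ℝ) ≤ i := by exact_mod_cast hi
  by_cases hbig : T ≤ (i:ℝ) ^ 2 ∧ c / 2 ≤ x ^ 2
  · obtain ⟨k, hk⟩ := hT i hi hbig.1 x hx hbig.2
    refine ⟨fun m => ENNReal.ofReal (C₁ * i) * (ENNReal.ofReal (clusterTail n₀ ((m - k) + (k - m)))
      + if m < k then ENNReal.ofReal (√((k:ℝ) * (k - m)))⁻¹ else 0), ?_, ?_⟩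
    · rw [ENNReal.tsum_mul_left]
      refine (mul_le_mul_right (hA k) _).trans ?_
      rw [← ENNReal.ofReal_mul (by positivity)]
      apply ENNReal.ofReal_le_ofReal
      have : 0 ≤ 3 / c * B * i := by positivity
      linarith
    · intro n m h1 h2 h3 h4 h5
      refine (ENNReal.ofReal_le_ofReal (hk n m h1 h2 h3 h4 h5)).trans (le_of_eq ?_)
      have e : ENNReal.ofReal (if m < k then (√((k:ℝ) * (k - m)))⁻¹ else 0) =
          if m < k then ENNReal.ofReal (√((k:ℝ) * (k - m)))⁻¹ else 0 := by
        split_ifs <;> simp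
      rw [ENNReal.ofReal_mul (by positivity), ENNReal.ofReal_add (clusterTail_nonneg _ _)
        (by split_ifs <;> positivity), e]
  · refine ⟨fun m => if m ≤ ⌊2 / c * (i:ℝ)⌋₊ then ENNReal.ofReal B else 0, ?_, ?_⟩
    · refine (tsum_ite_le_const hc0 hc1 hi hB0 (Nat.floor_le (by positivity))).trans ?_
      apply ENNReal.ofReal_le_ofReal
      have : 0 ≤ C₁ * A * i := by positivity
      linarith
    · intro n m h1 h2 h3 h4 h5
      have hn := le_of_cluster hc0 hc1 hi h3 h5
      beta_reduce
      rw [if_pos (Nat.le_floor ((Nat.cast_le.2 h2).trans hn))]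
      apply ENNReal.ofReal_le_ofReal
      have h4c : 0 ≤ 4 / c ^ 2 := by positivity
      rcases lt_or_ge ((i:ℝ) ^ 2) T with hiT | hiT
      · have hiT' : (i:ℝ) ≤ |T| + 1 := by nlinarith [le_abs_self T]
        have := hB₁ n m (Nat.le_floor (hn.trans (by gcongr))) h2 x hx
        linarith
      · have hx2 : x ^ 2 ≤ c / 2 := by
          by_contra hcon
          exact hbig ⟨hiT, (not_le.1 hcon).le⟩
        have := normLegendre_sq_le_of_allowed hη0 hη h1 h2 h3 hx (by rwa [sub_sub_cancel])
        rw [sub_sub_cancel] at this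
        linarith

/-- A majorant of the whole cluster by a function of the order alone. -/
lemma exists_majorant {η : ℝ} (hη0 : 0 ≤ η) (hη : η < 1) :
    ∃ C : ℝ, 0 ≤ C ∧ ∀ i : ℕ, 1 ≤ i → ∀ x ∈ Icc (0:ℝ) 1, ∃ G : ℕ → ℝ≥0∞,
      ∑' m, G m ≤ ENNReal.ofReal (C * i) ∧ ∀ n m : ℕ, m ≤ n →
        (m : ℝ) ^ 2 ≤ η * (n * (n + 1)) → (i:ℝ) ^ 2 ≤ n * (n + 1) - (m:ℝ) ^ 2 →
        n * (n + 1) - (m:ℝ) ^ 2 ≤ ((i:ℝ) + 1) ^ 2 →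
        ENNReal.ofReal (normLegendre n m x ^ 2) ≤ G m := by
  obtain ⟨C, hC, hG⟩ := exists_majorant_nonzero_order hη0 hη
  have hc : 0 < 1 - η := by linarith
  refine ⟨2 / (1 - η) + C, by positivity, fun i hi x hx => ?_⟩
  obtain ⟨G, hG1, hG2⟩ := hG i hi x hx
  refine ⟨fun m => (if m = 0 then ENNReal.ofReal (2 / (1 - η) * i) else 0) + G m, ?_, ?_⟩
  · rw [ENNReal.tsum_add, tsum_ite_eq, add_mul, ENNReal.ofReal_add (by positivity) (by positivity)]
    gcongr
  · intro n m h2 h3 h4 h5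
    beta_reduce
    rcases eq_or_ne m 0 with rfl | h1
    · rw [if_pos rfl]
      refine le_trans (ENNReal.ofReal_le_ofReal ?_) le_self_add
      have hi' : (1:ℝ) ≤ i := by exact_mod_cast hi
      have hn : 1 ≤ n := by
        rw [Nat.one_le_iff_ne_zero]
        rintro rfl
        norm_num at h4
        omega
      have hn' : (1:ℝ) ≤ n := by exact_mod_cast hn
      have hle := le_of_cluster (c := 1 - η) hc (by linarith) hi (by rwa [sub_sub_cancel]) h5
      refine (normLegendre_zero_order_le hn hx).trans (le_trans ?_ hle)
      rw [div_le_iff₀ (by positivity)]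
      nlinarith [Real.pi_gt_three]
    · rw [if_neg h1, zero_add]
      exact hG2 n m h1 h2 h3 h4 h5

/-- A cluster contains at most one degree for each order. -/
lemma degree_eq_of_cluster {i n n' m : ℕ} (h1 : i ^ 2 + m ^ 2 ≤ n * (n + 1))
    (h2 : n * (n + 1) ≤ (i + 1) ^ 2 + m ^ 2) (h1' : i ^ 2 + m ^ 2 ≤ n' * (n' + 1))
    (h2' : n' * (n' + 1) ≤ (i + 1) ^ 2 + m ^ 2) : n = n' := by
  have key : ∀ a b : ℕ, i ^ 2 + m ^ 2 ≤ a * (a + 1) → b * (b + 1) ≤ (i + 1) ^ 2 + m ^ 2 →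
      b ≤ a := fun a b ha hb => by
    by_contra! hlt
    have hia : i ≤ a := by
      by_contra! h
      nlinarith
    nlinarith
  exact le_antisymm (key _ _ h1' h2) (key _ _ h1 h2')

lemma sq_le_of_bessel_regime {ε Λ m n : ℝ} (hΛ : Λ = n * (n + 1)) (h1 : 1 ≤ Λ - m ^ 2)
    (h : |m| ≤ ε * (n + 1 / 2)) : m ^ 2 ≤ 5 * ε ^ 2 / (4 + ε ^ 2) * Λ := by
  have h2 := pow_le_pow_left₀ (abs_nonneg m) h 2
  rw [sq_abs] at h2
  rw [div_mul_eq_mul_div, le_div_iff₀ (by positivity)]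
  have h3 := mul_le_mul_of_nonneg_left h1 (sq_nonneg ε)
  subst hΛ
  linarith

lemma natAbs_cast_sq (m : ℤ) : ((m.natAbs : ℝ)) ^ 2 = (m : ℝ) ^ 2 := by
  rw [Nat.cast_natAbs, Int.cast_abs, sq_abs]

/-- spectral cluster estimate in the Bessel regime `|m| ≤ ε(ℓ+1/2)`:
`(1/i) ∑ |Ỹ_{ℓ,m}(x)|² ≤ C`, the sum being over `|m| ≤ ℓ`, `|m| ≤ ε(ℓ+1/2)`,
`λ_{ℓ,m} ∈ [i²,(i+1)²]`. -/
theorem statement17 (ε : ℝ) (hε : ε ∈ Set.Ioo (0:ℝ) 1) :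
    ∃ C : ℝ, 0 < C ∧
      ∀ i : ℕ, 1 ≤ i → ∀ x : ℝ, x ∈ Set.Icc (-1 : ℝ) 1 →
        ENNReal.ofReal (1/(i:ℝ)) *
          ∑' p : {p : ℕ × ℤ // p.2.natAbs ≤ p.1 ∧ |(p.2 : ℝ)| ≤ ε * ((p.1 : ℝ) + 1/2) ∧
              (i:ℝ)^2 ≤ eigenL p.1 p.2 ∧ eigenL p.1 p.2 ≤ ((i:ℝ)+1)^2},
            ENNReal.ofReal ((tY p.1.1 p.1.2 x)^2) ≤
          ENNReal.ofReal C := by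
  obtain ⟨hε0, hε1⟩ := hε
  have hη : 5 * ε ^ 2 / (4 + ε ^ 2) < 1 := by
    rw [div_lt_one (by positivity)]
    nlinarith
  obtain ⟨C, hC, hG⟩ := exists_majorant (by positivity) hη
  refine ⟨2 * C + 1, by positivity, fun i hi x hx => ?_⟩
  have hi' : (1:ℝ) ≤ i := by exact_mod_cast hi
  obtain ⟨G, hG1, hG2⟩ := hG i hi |x| ⟨abs_nonneg x, abs_le.2 hx⟩
  have hsum := tsum_le_two_mul_tsum (α := {p : ℕ × ℤ // p.2.natAbs ≤ p.1 ∧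
      |(p.2 : ℝ)| ≤ ε * ((p.1 : ℝ) + 1/2) ∧
      (i:ℝ)^2 ≤ eigenL p.1 p.2 ∧ eigenL p.1 p.2 ≤ ((i:ℝ)+1)^2})
    (a := fun p => p.1.2.natAbs) (b := fun p => decide (0 ≤ p.1.2)) ?_
    (f := fun p => ENNReal.ofReal ((tY p.1.1 p.1.2 x)^2)) (H := G) ?_
  · refine (mul_le_mul_right (hsum.trans (mul_le_mul_right hG1 2)) _).trans ?_
    rw [show (2:ℝ≥0∞) = ENNReal.ofReal 2 by simp, ← ENNReal.ofReal_mul (by positivity),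
      ← ENNReal.ofReal_mul (by positivity)]
    apply ENNReal.ofReal_le_ofReal
    have : 1 / (i:ℝ) * (2 * (C * i)) = 2 * C := by field_simp
    linarith
  · rintro ⟨⟨n, m⟩, _, _, h1, h2⟩ ⟨⟨n', m'⟩, _, _, h1', h2'⟩ h
    simp only [Prod.mk.injEq, decide_eq_decide] at h
    obtain rfl : m = m' := by omega
    simp only [eigenL, ← natAbs_cast_sq] at h1 h2 h1' h2'
    obtain rfl : n = n' := degree_eq_of_cluster (i := i) (m := m.natAbs)
      (by exact_mod_cast le_sub_iff_add_le.1 h1) (by exact_mod_cast sub_le_iff_le_add.1 h2)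
      (by exact_mod_cast le_sub_iff_add_le.1 h1') (by exact_mod_cast sub_le_iff_le_add.1 h2')
    rfl
  · rintro ⟨⟨n, m⟩, hmn, hm, h1, h2⟩
    have hm2 := sq_le_of_bessel_regime rfl (le_trans (one_le_pow₀ hi') h1) hm
    simp only [eigenL] at h1 h2
    rw [← natAbs_cast_sq] at h1 h2 hm2
    simp only [tY_sq_eq_normLegendre_abs hmn]
    exact hG2 n m.natAbs hmn hm2 h1 h2
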